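/- Let G be a finite simple graph with maximum degree at most 3 containing a triangle on vertices u, v, w. If no other triangle of G shares a vertex with uvw, let G' be the graph obtained from G by contracting {u,v,w} to a single new vertex, adjacent to exactly those vertices outside the triangle that are adjacent in G to u, v or w (a Δ–Y transformation); otherwise, if vwx is also a triangle of G, let G' be obtained from G by contracting {u,v,w,x} to a single new vertex adjacent to exactly those vertices outside {u,v,w,x} adjacent in G to one of u,v,w,x. If G' has a non-crossing polyline drawing in ℝ³ with at most 2 bends per edge and angular resolution at least 2π/3, then G also has a non-crossing polyline drawing in ℝ³ with at most 2 bends per edge and angular resolution at least 2π/3. -/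

import Mathlib

open InnerProductGeometry

noncomputable section

/-- Points of three-dimensional Euclidean space. -/
abbrev Pt : Type := EuclideanSpace ℝ (Fin 3)

/-- The image of a polyline given by a list of points: the union of the closed
segments between consecutive points. -/
def polyImage (l : List Pt) : Set Pt :=
  ⋃ q ∈ l.zip l.tail, segment ℝ q.1 q.2

/-- A polyline is simple (its image is a simple arc): consecutive points are distinct,
two consecutive segments meet exactly in their shared endpoint, and two
non-consecutive segments are disjoint. -/
def SimplePolyline (l : List Pt) : Prop :=
  l.Chain' (· ≠ ·) ∧
  ∀ i j : ℕ, ∀ hi : i + 1 < l.length, ∀ hj : j + 1 < l.length, i < j →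
    segment ℝ (l.get ⟨i, by omega⟩) (l.get ⟨i + 1, hi⟩) ∩
      segment ℝ (l.get ⟨j, by omega⟩) (l.get ⟨j + 1, hj⟩) =
      if j = i + 1 then {l.get ⟨j, by omega⟩} else ∅

/-- A polyline drawing of a (finite simple) graph `G` in ℝ³: an injective placement
`p` of the vertices, and for each (oriented) edge `uv` a list of points, starting at
`p u` and ending at `p v`, giving the polygonal path of the edge; the path of `vu`
is the reverse of the path of `uv`.  The interior points of the list are the bends
of the edge. -/
structure PolylineDrawing {V : Type*} (G : SimpleGraph V) where
  p : V → Pt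
  p_inj : Function.Injective p
  seq : ∀ u v : V, G.Adj u v → List Pt
  seq_head : ∀ u v h, (seq u v h).head? = some (p u)
  seq_last : ∀ u v h, (seq u v h).getLast? = some (p v)
  seq_symm : ∀ u v h, seq v u h.symm = (seq u v h).reverse

variable {V : Type*} {G : SimpleGraph V}

/-- Every edge is drawn with at most `k` bends, i.e. its point list has at most
`k + 2` points. -/
def MaxBends (D : PolylineDrawing G) (k : ℕ) : Prop :=
  ∀ u v h, (D.seq u v h).length ≤ k + 2

/-- The image of the whole drawing: all vertex points and all edge paths. -/
def drawingImage (D : PolylineDrawing G) : Set Pt :=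
  Set.range D.p ∪ ⋃ (u) (v) (h : G.Adj u v), polyImage (D.seq u v h)

/-- The drawing has angular resolution at least `θ`: the angle at every bend of every
edge, and the angle at a common vertex between the initial segments of any two
distinct edges, is at least `θ`. -/
def AngularResAtLeast (D : PolylineDrawing G) (θ : ℝ) : Prop :=
  (∀ u v h, ∀ a q b : Pt, [a, q, b] <:+: D.seq u v h →
    θ ≤ angle (a - q) (b - q)) ∧
  (∀ v u w : V, ∀ hu : G.Adj v u, ∀ hw : G.Adj v w, u ≠ w →
    ∀ a b : Pt, (D.seq v u hu)[1]? = some a → (D.seq v w hw)[1]? = some b →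
      θ ≤ angle (a - D.p v) (b - D.p v))

/-- The drawing is non-crossing: every edge path is a simple arc meeting the vertex
points only in its endpoints, and the paths of two distinct edges intersect exactly
in the images of their common endpoints. -/
def NonCrossing (D : PolylineDrawing G) : Prop :=
  (∀ u v h, SimplePolyline (D.seq u v h)) ∧
  (∀ u v h, polyImage (D.seq u v h) ∩ Set.range D.p = {D.p u, D.p v}) ∧
  (∀ u v u' v' : V, ∀ h : G.Adj u v, ∀ h' : G.Adj u' v', s(u, v) ≠ s(u', v') →
    polyImage (D.seq u v h) ∩ polyImage (D.seq u' v' h') =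
      D.p '' (({u, v} : Set V) ∩ {u', v'}))

open scoped RealInnerProductSpace

/-! ### Polylines -/

@[simp] theorem polyImage_nil : polyImage [] = ∅ := by simp [polyImage]

@[simp] theorem polyImage_singleton (a : Pt) : polyImage [a] = ∅ := by simp [polyImage]

@[simp] theorem polyImage_cons_cons (a b : Pt) (l : List Pt) :
    polyImage (a :: b :: l) = segment ℝ a b ∪ polyImage (b :: l) := by
  ext x
  simp [polyImage]

theorem mem_polyImage_iff_get {l : List Pt} {x : Pt} :
    x ∈ polyImage l ↔ ∃ i : ℕ, ∃ hi : i + 1 < l.length,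
      x ∈ segment ℝ (l.get ⟨i, by omega⟩) (l.get ⟨i + 1, hi⟩) := by
  induction l with
  | nil => simp
  | cons a l ih =>
    cases l with
    | nil => simp
    | cons b l =>
      rw [polyImage_cons_cons, Set.mem_union, ih]
      constructor
      · rintro (h | ⟨i, hi, h⟩)
        · exact ⟨0, by simp, by simpa using h⟩
        · exact ⟨i + 1, by simpa using hi, by simpa using h⟩
      · rintro ⟨i, hi, h⟩
        cases i with
        | zero => exact Or.inl (by simpa using h)
        | succ i => exact Or.inr ⟨i, by simpa using hi, by simpa using h⟩

theorem polyImage_reverse (l : List Pt) : polyImage l.reverse = polyImage l := by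
  have key : ∀ l : List Pt, polyImage l ⊆ polyImage l.reverse := by
    intro l x hx
    obtain ⟨i, hi, h⟩ := mem_polyImage_iff_get.1 hx
    refine mem_polyImage_iff_get.2 ⟨l.length - 2 - i, by simp; omega, ?_⟩
    have e1 : l.length - 1 - (l.length - 2 - i) = i + 1 := by omega
    have e2 : l.length - 1 - (l.length - 2 - i + 1) = i := by omega
    simp only [List.get_eq_getElem, List.getElem_reverse, e1, e2] at h ⊢
    rwa [segment_symm]
  refine Set.Subset.antisymm ?_ (key l)
  simpa using key l.reverse

theorem polyImage_subset_of_convex {l : List Pt} {C : Set Pt} (hC : Convex ℝ C)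
    (h : ∀ q ∈ l, q ∈ C) : polyImage l ⊆ C := by
  intro x hx
  obtain ⟨i, hi, hx⟩ := mem_polyImage_iff_get.1 hx
  exact hC.segment_subset (h _ (List.get_mem _ _)) (h _ (List.get_mem _ _)) hx

theorem mem_polyImage_of_mem {l : List Pt} (hl : 2 ≤ l.length) {q : Pt} (hq : q ∈ l) :
    q ∈ polyImage l := by
  obtain ⟨⟨i, hi⟩, rfl⟩ := List.get_of_mem hq
  by_cases h : i + 1 < l.length
  · exact mem_polyImage_iff_get.2 ⟨i, h, left_mem_segment ℝ _ _⟩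
  · have e : i - 1 + 1 = i := by omega
    refine mem_polyImage_iff_get.2 ⟨i - 1, by omega, ?_⟩
    simp only [e]
    exact right_mem_segment ℝ _ _

theorem isClosed_polyImage (l : List Pt) : IsClosed (polyImage l) := by
  have hseg : ∀ a b : Pt, IsClosed (segment ℝ a b) := fun a b => by
    rw [← convexHull_pair (𝕜 := ℝ)]
    exact ((Set.toFinite {a, b}).isCompact_convexHull (𝕜 := ℝ)).isClosed
  induction l with
  | nil => simp
  | cons a l ih =>
    cases l with
    | nil => simp
    | cons b l => simpa using (hseg a b).union ih

theorem simplePolyline_cons_cons {a b : Pt} {l : List Pt} :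
    SimplePolyline (a :: b :: l) ↔
      a ≠ b ∧ segment ℝ a b ∩ polyImage (b :: l) ⊆ {b} ∧ SimplePolyline (b :: l) := by
  constructor
  · rintro ⟨hc, h⟩
    obtain ⟨hab, hc'⟩ := List.isChain_cons_cons.1 hc
    refine ⟨hab, ?_, hc', ?_⟩
    · rintro x ⟨hx, hx'⟩
      obtain ⟨i, hi, hi'⟩ := mem_polyImage_iff_get.1 hx'
      have := h 0 (i + 1) (by simp) (by simpa using hi) (by omega)
      have hmem : x ∈ segment ℝ ((a :: b :: l).get ⟨0, by simp⟩)
          ((a :: b :: l).get ⟨0 + 1, by simp⟩) ∩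
          segment ℝ ((a :: b :: l).get ⟨i + 1, by simp at hi ⊢; omega⟩)
            ((a :: b :: l).get ⟨i + 1 + 1, by simpa using hi⟩) :=
        ⟨by simpa using hx, by simpa using hi'⟩
      rw [this] at hmem
      cases i with
      | zero => simpa using hmem
      | succ i => simp at hmem
    · intro i j hi hj hij
      have := h (i + 1) (j + 1) (by simpa using hi) (by simpa using hj) (by omega)
      simpa using this
  · rintro ⟨hab, hs, hc, h⟩
    refine ⟨List.isChain_cons_cons.2 ⟨hab, hc⟩, ?_⟩
    intro i j hi hj hij
    cases j with
    | zero => omega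
    | succ j =>
      cases i with
      | succ i =>
        have := h i j (by simpa using hi) (by simpa using hj) (by omega)
        simpa using this
      | zero =>
        have hsub : ∀ x ∈ segment ℝ a b, x ∈ segment ℝ ((b :: l).get ⟨j, by simp at hj ⊢; omega⟩)
            ((b :: l).get ⟨j + 1, by simpa using hj⟩) → x = b := fun x hx hx' =>
          hs ⟨hx, mem_polyImage_iff_get.2 ⟨j, by simpa using hj, hx'⟩⟩
        cases j with
        | zero =>
          ext x
          simp only [List.get_eq_getElem, List.getElem_cons_zero, List.getElem_cons_succ,
            Set.mem_inter_iff, if_true, Set.mem_singleton_iff]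
          constructor
          · rintro ⟨h1, h2⟩
            exact hsub x h1 (by simpa using h2)
          · rintro rfl
            exact ⟨right_mem_segment ℝ _ _, left_mem_segment ℝ _ _⟩
        | succ j =>
          rw [if_neg (by omega), Set.eq_empty_iff_forall_notMem]
          rintro x ⟨h1, h2⟩
          have hxb := hsub x (by simpa using h1) (by simpa using h2)
          subst hxb
          have h0 := h 0 (j + 1) (by simp at hj ⊢; omega) (by simpa using hj) (by omega)
          have hmem : x ∈ segment ℝ ((x :: l).get ⟨0, by simp⟩)
              ((x :: l).get ⟨0 + 1, by simp at hj ⊢; omega⟩) ∩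
              segment ℝ ((x :: l).get ⟨j + 1, by simp at hj ⊢; omega⟩)
                ((x :: l).get ⟨j + 1 + 1, by simpa using hj⟩) :=
            ⟨by simpa using left_mem_segment ℝ _ _, by simpa using h2⟩
          rw [h0] at hmem
          split_ifs at hmem with hj0
          · obtain rfl : j = 0 := by omega
            cases l with
            | nil => simp at hj
            | cons c l =>
              have := (List.isChain_cons_cons.1 hc).1
              simp at hmem
              exact this hmem
          · exact hmem

theorem SimplePolyline.reverse {l : List Pt} (h : SimplePolyline l) :
    SimplePolyline l.reverse := by
  refine ⟨?_, ?_⟩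
  · have := h.1
    unfold List.Chain' at this ⊢
    rw [List.isChain_reverse]
    exact this.imp fun a b hab => hab.symm
  · intro i j hi hj hij
    simp only [List.length_reverse] at hi hj
    have := h.2 (l.length - 2 - j) (l.length - 2 - i) (by omega) (by omega) (by omega)
    have e1 : l.length - 2 - i + 1 = l.length - 1 - i := by omega
    have e2 : l.length - 2 - j + 1 = l.length - 1 - j := by omega
    have e3 : l.length - 2 - i = l.length - 1 - (i + 1) := by omega
    have e4 : l.length - 2 - j = l.length - 1 - (j + 1) := by omega
    simp only [List.get_eq_getElem, List.getElem_reverse] at this ⊢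
    rw [segment_symm, Set.inter_comm, segment_symm ℝ (l[l.length - 1 - j])]
    simp only [e1, e2] at this
    simp only [e3, e4] at this
    rw [this]
    by_cases hij' : j = i + 1
    · subst hij'
      rw [if_pos (by omega), if_pos rfl]
    · rw [if_neg (by omega), if_neg hij']

theorem simplePolyline_of_strictMono (f : Pt →ₗ[ℝ] ℝ) {l : List Pt}
    (h : l.Pairwise (fun a b => f a < f b)) : SimplePolyline l := by
  induction l with
  | nil => exact ⟨List.isChain_nil, fun i j hi => by simp at hi⟩
  | cons a l ih =>
    cases l with
    | nil => exact ⟨List.isChain_singleton a, fun i j hi => by simp at hi⟩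
    | cons b l =>
      obtain ⟨ha, hc⟩ := List.pairwise_cons.1 h
      have hab : f a < f b := ha b (by simp)
      refine simplePolyline_cons_cons.2 ⟨fun e => by simp [e] at hab, ?_, ih hc⟩
      rintro x ⟨hx, hx'⟩
      have hge : polyImage (b :: l) ⊆ {x | f b ≤ f x} := by
        refine polyImage_subset_of_convex (convex_halfSpace_ge f.isLinear (f b)) ?_
        intro q hq
        rcases List.mem_cons.1 hq with rfl | hq
        · exact le_refl (f q)
        · exact ((List.pairwise_cons.1 hc).1 q hq).le
      have hb : f b ≤ f x := hge hx'
      obtain ⟨s, t, hs, ht, hst, rfl⟩ := hx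
      simp only [map_add, map_smul, smul_eq_mul] at hb
      have hs0 : s = 0 := by
        by_contra hne
        have : 0 < s := lt_of_le_of_ne hs (Ne.symm hne)
        obtain rfl : t = 1 - s := by linarith
        nlinarith [mul_pos this (sub_pos.2 hab)]
      obtain rfl : t = 1 := by linarith
      simp [hs0]

/-! ### Drawings as plain functions -/

/-- `p` and `S` form a non-crossing polyline drawing of `Γ` with at most two bends per edge and
angular resolution at least `θ`; here `S u v` is only meaningful when `u` and `v` are adjacent. -/
structure IsGoodDrawing {W : Type*} (Γ : SimpleGraph W) (p : W → Pt) (S : W → W → List Pt)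
    (θ : ℝ) : Prop where
  inj : Function.Injective p
  head : ∀ u v, Γ.Adj u v → (S u v).head? = some (p u)
  symm : ∀ u v, Γ.Adj u v → S v u = (S u v).reverse
  simple : ∀ u v, Γ.Adj u v → SimplePolyline (S u v)
  meets : ∀ u v, Γ.Adj u v → polyImage (S u v) ∩ Set.range p = {p u, p v}
  pair : ∀ u v u' v', Γ.Adj u v → Γ.Adj u' v' → s(u, v) ≠ s(u', v') →
    polyImage (S u v) ∩ polyImage (S u' v') = p '' (({u, v} : Set W) ∩ {u', v'})
  length : ∀ u v, Γ.Adj u v → (S u v).length ≤ 4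
  bend : ∀ u v, Γ.Adj u v → ∀ a q b : Pt, [a, q, b] <:+: S u v → θ ≤ angle (a - q) (b - q)
  star : ∀ v u w, Γ.Adj v u → Γ.Adj v w → u ≠ w → ∀ a b : Pt, (S v u)[1]? = some a →
    (S v w)[1]? = some b → θ ≤ angle (a - p v) (b - p v)

/-- `Γ` has a drawing with the properties required in `IsGoodDrawing`. -/
def HasGoodDrawing {W : Type*} (Γ : SimpleGraph W) (θ : ℝ) : Prop :=
  ∃ p S, IsGoodDrawing Γ p S θ

theorem hasGoodDrawing_iff {W : Type*} {Γ : SimpleGraph W} {θ : ℝ} :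
    HasGoodDrawing Γ θ ↔
      ∃ D : PolylineDrawing Γ, NonCrossing D ∧ MaxBends D 2 ∧ AngularResAtLeast D θ := by
  classical
  constructor
  · rintro ⟨p, S, h⟩
    refine ⟨⟨p, h.inj, fun u v _ => S u v, h.head, fun u v huv => ?_, h.symm⟩,
      ⟨h.simple, h.meets, h.pair⟩, h.length, h.bend, h.star⟩
    have := h.head v u huv.symm
    rwa [h.symm u v huv, List.head?_reverse] at this
  · rintro ⟨D, ⟨h1, h2, h3⟩, h4, h5, h6⟩
    refine ⟨D.p, fun u v => if h : Γ.Adj u v then D.seq u v h else [], D.p_inj, ?_, ?_, ?_, ?_,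
      ?_, ?_, ?_, ?_⟩
    · intro u v h
      simpa [h] using D.seq_head u v h
    · intro u v h
      simpa [h, h.symm] using D.seq_symm u v h
    · intro u v h
      simpa [h] using h1 u v h
    · intro u v h
      simpa [h] using h2 u v h
    · intro u v u' v' h h' hne
      simpa only [h, h', dif_pos] using h3 u v u' v' h h' hne
    · intro u v h
      simpa [h] using h4 u v h
    · intro u v h
      simpa [h] using h5 u v h
    · intro v u w hu hw
      simpa only [hu, hw, dif_pos] using h6 v u w hu hw

theorem IsGoodDrawing.comap {W W' : Type*} {Γ : SimpleGraph W} {Γ' : SimpleGraph W'}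
    {p : W → Pt} {S : W → W → List Pt} {θ : ℝ} (h : IsGoodDrawing Γ p S θ) (f : W' → W)
    (hf : Function.Injective f) (hadj : ∀ a b, Γ'.Adj a b → Γ.Adj (f a) (f b)) :
    IsGoodDrawing Γ' (p ∘ f) (fun a b => S (f a) (f b)) θ where
  inj := h.inj.comp hf
  head u v huv := h.head _ _ (hadj _ _ huv)
  symm u v huv := h.symm _ _ (hadj _ _ huv)
  simple u v huv := h.simple _ _ (hadj _ _ huv)
  meets u v huv := by
    refine Set.Subset.antisymm ?_ ?_
    · rw [Function.comp_apply, Function.comp_apply, ← h.meets _ _ (hadj _ _ huv)]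
      exact Set.inter_subset_inter_right _ (Set.range_comp_subset_range f p)
    · have := (h.meets _ _ (hadj _ _ huv)).ge
      rintro x (rfl | rfl)
      · exact ⟨(this (by simp)).1, ⟨u, rfl⟩⟩
      · exact ⟨(this (by simp)).1, ⟨v, rfl⟩⟩
  pair u v u' v' huv huv' hne := by
    rw [h.pair _ _ _ _ (hadj _ _ huv) (hadj _ _ huv')]
    · rw [Set.image_comp, Set.image_inter hf, Set.image_pair, Set.image_pair]
    · intro e
      apply hne
      have : Sym2.map f s(u, v) = Sym2.map f s(u', v') := by simpa using e
      exact Sym2.map.injective hf this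
  length u v huv := h.length _ _ (hadj _ _ huv)
  bend u v huv := h.bend _ _ (hadj _ _ huv)
  star v u w hu hw hne := h.star _ _ _ (hadj _ _ hu) (hadj _ _ hw) (hf.ne hne)

theorem IsGoodDrawing.last {W : Type*} {Γ : SimpleGraph W} {p : W → Pt} {S : W → W → List Pt}
    {θ : ℝ} (h : IsGoodDrawing Γ p S θ) {u v : W} (huv : Γ.Adj u v) :
    (S u v).getLast? = some (p v) := by
  have := h.head v u huv.symm
  rwa [h.symm u v huv, List.head?_reverse] at this

theorem IsGoodDrawing.exists_eq_cons_cons {W : Type*} {Γ : SimpleGraph W} {p : W → Pt}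
    {S : W → W → List Pt} {θ : ℝ} (h : IsGoodDrawing Γ p S θ) {u v : W} (huv : Γ.Adj u v) :
    ∃ q l, S u v = p u :: q :: l := by
  have h1 := h.head u v huv
  have h2 := h.last huv
  match hS : S u v with
  | [] => simp [hS] at h1
  | [a] =>
    simp only [hS, List.head?_cons, List.getLast?_singleton] at h1 h2
    exact absurd (h.inj (Option.some_inj.1 (h1.symm.trans h2))) huv.ne
  | a :: q :: l =>
    simp only [hS, List.head?_cons, Option.some_inj] at h1
    exact ⟨q, l, by rw [h1]⟩

theorem bend_reverse {l : List Pt} {θ : ℝ}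
    (h : ∀ a q b : Pt, [a, q, b] <:+: l → θ ≤ angle (a - q) (b - q)) (a q b : Pt)
    (hl : [a, q, b] <:+: l.reverse) : θ ≤ angle (a - q) (b - q) := by
  rw [angle_comm]
  exact h b q a (by rw [← List.reverse_infix]; simpa using hl)

/-! ### Images under similarities -/

theorem polyImage_map {f : Pt → Pt} (hf : ∀ a b, f '' segment ℝ a b = segment ℝ (f a) (f b))
    (l : List Pt) : polyImage (l.map f) = f '' polyImage l := by
  induction l with
  | nil => simp
  | cons a l ih =>
    cases l with
    | nil => simp
    | cons b l =>
      rw [List.map_cons, List.map_cons, polyImage_cons_cons, ← List.map_cons, ih,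
        polyImage_cons_cons, Set.image_union, hf]

theorem SimplePolyline.map {f : Pt → Pt} (hinj : Function.Injective f)
    (hf : ∀ a b, f '' segment ℝ a b = segment ℝ (f a) (f b)) {l : List Pt}
    (h : SimplePolyline l) : SimplePolyline (l.map f) := by
  induction l with
  | nil => simpa using h
  | cons a l ih =>
    cases l with
    | nil => exact ⟨List.isChain_singleton _, fun i j hi => by simp at hi⟩
    | cons b l =>
      obtain ⟨h1, h2, h3⟩ := simplePolyline_cons_cons.1 h
      refine simplePolyline_cons_cons.2 ⟨hinj.ne h1, ?_, ih h3⟩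
      rw [← List.map_cons, polyImage_map hf, ← hf, ← Set.image_inter hinj]
      simpa using Set.image_mono (f := f) h2

theorem IsGoodDrawing.map {W : Type*} {Γ : SimpleGraph W} {p : W → Pt} {S : W → W → List Pt}
    {θ : ℝ} (h : IsGoodDrawing Γ p S θ) {f : Pt → Pt} (hinj : Function.Injective f)
    (hf : ∀ a b, f '' segment ℝ a b = segment ℝ (f a) (f b))
    (hang : ∀ a q b, angle (f a - f q) (f b - f q) = angle (a - q) (b - q)) :
    IsGoodDrawing Γ (f ∘ p) (fun u v => (S u v).map f) θ where
  inj := hinj.comp h.inj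
  head u v huv := by simp [h.head u v huv]
  symm u v huv := by simp [h.symm u v huv]
  simple u v huv := (h.simple u v huv).map hinj hf
  meets u v huv := by
    rw [polyImage_map hf, Set.range_comp, ← Set.image_inter hinj, h.meets u v huv,
      Set.image_pair]
    rfl
  pair u v u' v' huv huv' hne := by
    rw [polyImage_map hf, polyImage_map hf, ← Set.image_inter hinj, h.pair u v u' v' huv huv' hne,
      Set.image_comp]
  length u v huv := by simpa using h.length u v huv
  bend u v huv a q b hl := by
    obtain ⟨l', hl', e⟩ := List.infix_map_iff.1 hl
    match l', e with
    | [a', q', b'], e =>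
      simp only [List.map_cons, List.map_nil, List.cons.injEq, and_true] at e
      obtain ⟨rfl, rfl, rfl⟩ := e
      rw [hang]
      exact h.bend u v huv _ _ _ hl'
  star v u w hu hw hne a b ha hb := by
    rw [List.getElem?_map, Option.map_eq_some_iff] at ha hb
    obtain ⟨a, ha, rfl⟩ := ha
    obtain ⟨b, hb, rfl⟩ := hb
    rw [Function.comp_apply, hang]
    exact h.star v u w hu hw hne a b ha hb

/-- The similarity of space with ratio `ε`, linear part `L` and value `c` at the origin. -/
def similarity (c : Pt) (ε : ℝ) (L : Pt ≃ₗᵢ[ℝ] Pt) (x : Pt) : Pt := c + ε • L x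

theorem similarity_injective (c : Pt) {ε : ℝ} (hε : 0 < ε) (L : Pt ≃ₗᵢ[ℝ] Pt) :
    Function.Injective (similarity c ε L) := by
  intro x y h
  have := add_left_cancel h
  exact L.injective (smul_right_injective _ hε.ne' this)

theorem similarity_image_segment (c : Pt) (ε : ℝ) (L : Pt ≃ₗᵢ[ℝ] Pt) (a b : Pt) :
    similarity c ε L '' segment ℝ a b =
      segment ℝ (similarity c ε L a) (similarity c ε L b) := by
  have := image_segment ℝ
    (AffineMap.const ℝ Pt c + ε • (L.toLinearEquiv : Pt →ₗ[ℝ] Pt).toAffineMap) a b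
  exact this

theorem similarity_angle (c : Pt) {ε : ℝ} (hε : 0 < ε) (L : Pt ≃ₗᵢ[ℝ] Pt) (a q b : Pt) :
    angle (similarity c ε L a - similarity c ε L q) (similarity c ε L b - similarity c ε L q) =
      angle (a - q) (b - q) := by
  have e : ∀ x, similarity c ε L x - similarity c ε L q = ε • L (x - q) := fun x => by
    simp only [similarity, map_sub, smul_sub]
    abel
  rw [e, e, angle_smul_left_of_pos _ _ hε, angle_smul_right_of_pos _ _ hε]
  exact L.toLinearIsometry.angle_map _ _

/-! ### Shortening a polyline at its initial point -/

theorem segment_subset_of_shorten {c g q : Pt} {t : ℝ} (ht : 0 < t) (ht1 : t < 1)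
    (hg : g = c + t • (q - c)) : segment ℝ g q ⊆ segment ℝ c q := by
  refine (convex_segment c q).segment_subset ?_ (right_mem_segment ℝ _ _)
  rw [segment_eq_image']
  exact ⟨t, ⟨ht.le, ht1.le⟩, hg.symm⟩

theorem notMem_segment_of_shorten {c g q : Pt} {t : ℝ} (hcq : c ≠ q) (ht : 0 < t) (ht1 : t < 1)
    (hg : g = c + t • (q - c)) : c ∉ segment ℝ g q := by
  rw [segment_eq_image']
  rintro ⟨s, ⟨hs0, hs1⟩, hs⟩
  have e : (t + s * (1 - t)) • (q - c) = 0 := by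
    have hs' : g + s • (q - g) = c := hs
    calc (t + s * (1 - t)) • (q - c) = (c + t • (q - c)) + s • (q - (c + t • (q - c))) - c := by
          module
      _ = 0 := by rw [← hg, hs', sub_self]
  rcases smul_eq_zero.1 e with h | h
  · nlinarith [mul_nonneg hs0 (sub_nonneg.2 ht1.le)]
  · exact hcq (sub_eq_zero.1 h).symm

theorem polyImage_shorten_subset {c g q : Pt} {l : List Pt} {t : ℝ} (ht : 0 < t) (ht1 : t < 1)
    (hg : g = c + t • (q - c)) : polyImage (g :: q :: l) ⊆ polyImage (c :: q :: l) := by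
  rw [polyImage_cons_cons, polyImage_cons_cons]
  exact Set.union_subset_union_left _ (segment_subset_of_shorten ht ht1 hg)

theorem SimplePolyline.shorten {c g q : Pt} {l : List Pt} {t : ℝ} (ht : 0 < t) (ht1 : t < 1)
    (hg : g = c + t • (q - c)) (h : SimplePolyline (c :: q :: l)) :
    SimplePolyline (g :: q :: l) := by
  obtain ⟨h1, h2, h3⟩ := simplePolyline_cons_cons.1 h
  refine simplePolyline_cons_cons.2 ⟨?_, ?_, h3⟩
  · intro e
    have : (1 - t) • (q - c) = 0 := by
      rw [sub_smul, one_smul, sub_eq_zero, sub_eq_iff_eq_add', ← hg, e]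
    rcases smul_eq_zero.1 this with h | h
    · linarith
    · exact h1 (sub_eq_zero.1 h).symm
  · exact (Set.inter_subset_inter_left _ (segment_subset_of_shorten ht ht1 hg)).trans h2

theorem bend_shorten {c g q : Pt} {l : List Pt} {t θ : ℝ} (ht1 : t < 1)
    (hg : g = c + t • (q - c))
    (h : ∀ a x b : Pt, [a, x, b] <:+: c :: q :: l → θ ≤ angle (a - x) (b - x)) (a x b : Pt)
    (hl : [a, x, b] <:+: g :: q :: l) : θ ≤ angle (a - x) (b - x) := by
  rcases List.infix_cons_iff.1 hl with hp | hi
  · match l, hp with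
    | b' :: l, hp =>
      simp only [List.cons_prefix_cons, List.nil_prefix, and_true] at hp
      obtain ⟨rfl, rfl, rfl⟩ := hp
      have := h c x b (List.IsPrefix.isInfix (by simp))
      have e : a - x = (1 - t) • (c - x) := by rw [hg]; module
      rwa [e, angle_smul_left_of_pos _ _ (by linarith)]
    | [], hp => simp at hp
  · exact h a x b (List.infix_cons_iff.2 (Or.inr hi))

theorem reverse_shorten_get_one {c g q z a : Pt} {l : List Pt} {t : ℝ} (ht1 : t < 1)
    (hg : g = c + t • (q - c)) (hz : (c :: q :: l).getLast? = some z)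
    (ha : (g :: q :: l).reverse[1]? = some a) :
    ∃ a', (c :: q :: l).reverse[1]? = some a' ∧ ∃ s : ℝ, 0 < s ∧ a - z = s • (a' - z) := by
  cases l with
  | nil =>
    simp only [List.getLast?_cons_cons, List.getLast?_singleton, Option.some_inj] at hz
    simp only [List.reverse_cons, List.reverse_nil, List.nil_append, List.cons_append,
      List.getElem?_cons_succ, List.getElem?_cons_zero, Option.some_inj] at ha
    subst hz ha
    exact ⟨c, by simp, 1 - t, by linarith, by rw [hg]; module⟩
  | cons b l =>
    refine ⟨a, ?_, 1, one_pos, (one_smul _ _).symm⟩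
    rw [List.reverse_cons, List.getElem?_append_left (by simp)] at ha ⊢
    exact ha

/-! ### Blowing up a vertex -/

/-- The polylines of a drawing in which the vertex `y` of a drawing with polylines `S` is replaced
by a small drawing with vertices `g` and polylines `T`. -/
def blowUpSeq {κ W : Type*} {y : W} (g : κ → Pt) (T : κ → κ → List Pt) (S : W → W → List Pt) :
    κ ⊕ {b : W // b ≠ y} → κ ⊕ {b : W // b ≠ y} → List Pt
  | .inl i, .inl j => T i j
  | .inl i, .inr b => g i :: (S y b).tail
  | .inr b, .inl i => (g i :: (S y b).tail).reverse
  | .inr b, .inr c => S b c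

theorem IsGoodDrawing.blowUp {κ W : Type*} {Γ₀ : SimpleGraph W} {y : W} {p : W → Pt}
    {S : W → W → List Pt} {θ : ℝ} (h₀ : IsGoodDrawing Γ₀ p S θ)
    {Γ : SimpleGraph (κ ⊕ {b : W // b ≠ y})} {g : κ → Pt} {T : κ → κ → List Pt}
    (hg : IsGoodDrawing (Γ.comap Sum.inl) g T θ)
    (hrr : ∀ b c, Γ.Adj (.inr b) (.inr c) → Γ₀.Adj b c)
    (hlr : ∀ i b, Γ.Adj (.inl i) (.inr b) → Γ₀.Adj y b)
    (huniq : ∀ i b c, Γ.Adj (.inl i) (.inr b) → Γ.Adj (.inl i) (.inr c) → b = c)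
    (huniq' : ∀ i j b, Γ.Adj (.inl i) (.inr b) → Γ.Adj (.inl j) (.inr b) → i = j)
    {R : ℝ} (hR : 0 < R) (hgR : ∀ j, g j ∈ Metric.ball (p y) R)
    (hTR : ∀ j k, Γ.Adj (.inl j) (.inl k) → polyImage (T j k) ⊆ Metric.ball (p y) R)
    (hpR : ∀ b, b ≠ y → p b ∉ Metric.ball (p y) R)
    (hSR : ∀ a b, Γ₀.Adj a b → a ≠ y → b ≠ y → ∀ x ∈ polyImage (S a b), x ∉ Metric.ball (p y) R)
    (hSR' : ∀ b, Γ₀.Adj y b → ∀ x ∈ polyImage (S y b).tail, x ∉ Metric.ball (p y) R)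
    (hpos : ∀ i b q, Γ.Adj (.inl i) (.inr b) → (S y b)[1]? = some q →
      ∃ t : ℝ, 0 < t ∧ t < 1 ∧ g i = p y + t • (q - p y))
    (hray : ∀ i b q, Γ.Adj (.inl i) (.inr b) → (S y b)[1]? = some q → ∀ j,
      g j ∈ segment ℝ (g i) q → g j = g i)
    (hray' : ∀ i b q, Γ.Adj (.inl i) (.inr b) → (S y b)[1]? = some q → ∀ j k,
      Γ.Adj (.inl j) (.inl k) → ∀ x ∈ polyImage (T j k), x ∈ segment ℝ (g i) q → x = g i)
    (hang : ∀ i b q, Γ.Adj (.inl i) (.inr b) → (S y b)[1]? = some q → ∀ j,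
      Γ.Adj (.inl i) (.inl j) → ∀ a, (T i j)[1]? = some a → θ ≤ angle (a - g i) (q - g i)) :
    IsGoodDrawing Γ (Sum.elim g fun b => p b) (blowUpSeq g T S) θ := by
  set P : κ ⊕ {b : W // b ≠ y} → Pt := Sum.elim g fun b => p b with hP
  set E : κ ⊕ {b : W // b ≠ y} → κ ⊕ {b : W // b ≠ y} → List Pt := blowUpSeq g T S with hE
  have hcR : p y ∈ Metric.ball (p y) R := Metric.mem_ball_self hR
  have attach : ∀ i b, Γ.Adj (.inl i) (.inr b) → ∃ (q : Pt) (l : List Pt) (t : ℝ),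
      S y b = p y :: q :: l ∧ 0 < t ∧ t < 1 ∧
      g i = p y + t • (q - p y) ∧ E (.inl i) (.inr b) = g i :: q :: l ∧ p y ≠ q ∧
      (S y b)[1]? = some q := by
    intro i b hib
    obtain ⟨q, l, hS⟩ := h₀.exists_eq_cons_cons (hlr i b hib)
    have hq : (S y b)[1]? = some q := by simp [hS]
    obtain ⟨t, ht, ht1, hgt⟩ := hpos i b q hib hq
    have hs := h₀.simple _ _ (hlr i b hib)
    rw [hS] at hs
    exact ⟨q, l, t, hS, ht, ht1, hgt, by simp [hE, blowUpSeq, hS],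
      (simplePolyline_cons_cons.1 hs).1, hq⟩
  have symm : ∀ u v, Γ.Adj u v → E v u = (E u v).reverse := by
    rintro (i | b) (j | c) h
    · exact hg.symm i j h
    · rfl
    · simp [hE, blowUpSeq]
    · exact h₀.symm _ _ (hrr _ _ h)
  have psymm : ∀ u v, Γ.Adj u v → polyImage (E v u) = polyImage (E u v) := fun u v h => by
    rw [symm u v h, polyImage_reverse]
  have att_sub : ∀ i b, Γ.Adj (.inl i) (.inr b) →
      polyImage (E (.inl i) (.inr b)) ⊆ polyImage (S y b) := by
    intro i b hib
    obtain ⟨q, l, t, hS, ht, ht1, hgt, hEq, -, -⟩ := attach i b hib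
    rw [hEq, hS]
    exact polyImage_shorten_subset ht ht1 hgt
  have att_not : ∀ i b, Γ.Adj (.inl i) (.inr b) → p y ∉ polyImage (E (.inl i) (.inr b)) := by
    intro i b hib
    obtain ⟨q, l, t, hS, ht, ht1, hgt, hEq, hne, -⟩ := attach i b hib
    rw [hEq, polyImage_cons_cons]
    rintro (h | h)
    · exact notMem_segment_of_shorten hne ht ht1 hgt h
    · exact hSR' b (hlr i b hib) _ (by rwa [hS]) hcR
  have att_near : ∀ i b, Γ.Adj (.inl i) (.inr b) → ∀ x ∈ polyImage (E (.inl i) (.inr b)),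
      x ∈ Metric.ball (p y) R → ∃ q, (S y b)[1]? = some q ∧ x ∈ segment ℝ (g i) q := by
    intro i b hib x hx hxR
    obtain ⟨q, l, t, hS, ht, ht1, hgt, hEq, hne, hq⟩ := attach i b hib
    rw [hEq, polyImage_cons_cons] at hx
    rcases hx with h | h
    · exact ⟨q, hq, h⟩
    · exact absurd hxR (hSR' b (hlr i b hib) _ (by rwa [hS]))
  have head : ∀ u v, Γ.Adj u v → (E u v).head? = some (P u) := by
    rintro (i | b) (j | c) h
    · exact hg.head i j h
    · rfl
    · obtain ⟨q, l, t, hS, -, -, -, hEq, -, -⟩ := attach j b h.symm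
      have := h₀.last (hlr j b h.symm)
      rw [symm _ _ h.symm, List.head?_reverse, hEq]
      rw [hS, List.getLast?_cons_cons] at this
      rwa [List.getLast?_cons_cons]
    · exact h₀.head _ _ (hrr _ _ h)
  have two_le : ∀ u v, Γ.Adj u v → 2 ≤ (E u v).length := by
    rintro (i | b) (j | c) h
    · obtain ⟨q, l, hq⟩ := hg.exists_eq_cons_cons (show (Γ.comap Sum.inl).Adj i j from h)
      simp [hE, blowUpSeq, hq]
    · obtain ⟨q, l, t, -, -, -, -, hEq, -, -⟩ := attach i c h
      simp [hEq]
    · obtain ⟨q, l, t, -, -, -, -, hEq, -, -⟩ := attach j b h.symm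
      simp [symm _ _ h.symm, hEq]
    · obtain ⟨q, l, hq⟩ := h₀.exists_eq_cons_cons (hrr _ _ h)
      simp [hE, blowUpSeq, hq]
  have left_mem : ∀ u v, Γ.Adj u v → P u ∈ polyImage (E u v) := fun u v h =>
    mem_polyImage_of_mem (two_le u v h) (List.mem_of_mem_head? (head u v h))
  have inj : Function.Injective P := by
    rintro (i | b) (j | c) h
    · exact congrArg _ (hg.inj h)
    · exact absurd (hgR i) (by rw [show g i = p c from h]; exact hpR c c.2)
    · exact absurd (hgR j) (by rw [← show p b = g j from h]; exact hpR b b.2)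
    · exact congrArg _ (Subtype.ext (h₀.inj h))
  have simple : ∀ u v, Γ.Adj u v → SimplePolyline (E u v) := by
    have key : ∀ i b, Γ.Adj (.inl i) (.inr b) → SimplePolyline (E (.inl i) (.inr b)) := by
      intro i b h
      obtain ⟨q, l, t, hS, ht, ht1, hgt, hEq, -, -⟩ := attach i b h
      rw [hEq]
      exact SimplePolyline.shorten ht ht1 hgt (hS ▸ h₀.simple _ _ (hlr i b h))
    rintro (i | b) (j | c) h
    · exact hg.simple i j h
    · exact key i c h
    · rw [symm _ _ h.symm]
      exact (key j b h.symm).reverse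
    · exact h₀.simple _ _ (hrr _ _ h)
  have bend : ∀ u v, Γ.Adj u v → ∀ a q b : Pt, [a, q, b] <:+: E u v →
      θ ≤ angle (a - q) (b - q) := by
    have key : ∀ i b, Γ.Adj (.inl i) (.inr b) → ∀ a x z : Pt,
        [a, x, z] <:+: E (.inl i) (.inr b) → θ ≤ angle (a - x) (z - x) := by
      intro i b h
      obtain ⟨q, l, t, hS, ht, ht1, hgt, hEq, -, -⟩ := attach i b h
      rw [hEq]
      exact bend_shorten ht1 hgt (hS ▸ h₀.bend _ _ (hlr i b h))
    rintro (i | b) (j | c) h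
    · exact hg.bend i j h
    · exact key i c h
    · rw [symm _ _ h.symm]
      exact bend_reverse (key j b h.symm)
    · exact h₀.bend _ _ (hrr _ _ h)
  have length : ∀ u v, Γ.Adj u v → (E u v).length ≤ 4 := by
    have key : ∀ i b, Γ.Adj (.inl i) (.inr b) → (E (.inl i) (.inr b)).length ≤ 4 := by
      intro i b h
      obtain ⟨q, l, t, hS, -, -, -, hEq, -, -⟩ := attach i b h
      have := h₀.length _ _ (hlr i b h)
      rw [hS] at this
      rw [hEq]
      simpa using this
    rintro (i | b) (j | c) h
    · exact hg.length i j h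
    · exact key i c h
    · rw [symm _ _ h.symm, List.length_reverse]
      exact key j b h.symm
    · exact h₀.length _ _ (hrr _ _ h)
  have star : ∀ v u w, Γ.Adj v u → Γ.Adj v w → u ≠ w → ∀ a b : Pt, (E v u)[1]? = some a →
      (E v w)[1]? = some b → θ ≤ angle (a - P v) (b - P v) := by
    have keyl : ∀ i j b, Γ.Adj (.inl i) (.inl j) → Γ.Adj (.inl i) (.inr b) → ∀ a x : Pt,
        (E (.inl i) (.inl j))[1]? = some a → (E (.inl i) (.inr b))[1]? = some x →
        θ ≤ angle (a - P (.inl i)) (x - P (.inl i)) := by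
      intro i j b hj hb a x ha hx
      obtain ⟨q, l, t, hS, -, -, -, hEq, -, hq⟩ := attach i b hb
      rw [hEq] at hx
      obtain rfl : q = x := by simpa using hx
      exact hang i b q hb hq j hj a ha
    have keyr : ∀ b c i, Γ.Adj (.inr b) (.inr c) → Γ.Adj (.inr b) (.inl i) → ∀ a x : Pt,
        (E (.inr b) (.inr c))[1]? = some a → (E (.inr b) (.inl i))[1]? = some x →
        θ ≤ angle (a - P (.inr b)) (x - P (.inr b)) := by
      intro b c i hc hi a x ha hx
      obtain ⟨q, l, t, hS, ht, ht1, hgt, hEq, -, hq⟩ := attach i b hi.symm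
      have hyb := hlr i b hi.symm
      rw [symm _ _ hi.symm, hEq] at hx
      have hlast := h₀.last hyb
      rw [hS] at hlast
      obtain ⟨x', hx', s, hs, e⟩ := reverse_shorten_get_one ht1 hgt hlast hx
      rw [← hS, ← h₀.symm _ _ hyb] at hx'
      have := h₀.star _ _ _ (hrr _ _ hc) hyb.symm c.2 a x' ha hx'
      rw [show P (.inr b) = p b from rfl, e, angle_smul_right_of_pos _ _ hs]
      exact this
    rintro (i | b) (j | c) (k | d) h h' hne a x ha hx
    · exact hg.star i j k h h' (fun e => hne (e ▸ rfl)) a x ha hx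
    · exact keyl i j d h h' a x ha hx
    · rw [angle_comm]
      exact keyl i k c h' h x a hx ha
    · exact absurd (congrArg _ (huniq i c d h h')) hne
    · exact absurd (congrArg _ (huniq' j k b h.symm h'.symm)) hne
    · rw [angle_comm]
      exact keyr b d j h' h x a hx ha
    · exact keyr b c k h h' a x ha hx
    · exact h₀.star _ _ _ (hrr _ _ h) (hrr _ _ h') (fun e => hne (congrArg _ (Subtype.ext e)))
        a x ha hx
  have meets : ∀ u v, Γ.Adj u v → ∀ w, P w ∈ polyImage (E u v) → w = u ∨ w = v := by
    have key : ∀ i b, Γ.Adj (.inl i) (.inr b) → ∀ w, P w ∈ polyImage (E (.inl i) (.inr b)) →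
        w = .inl i ∨ w = .inr b := by
      rintro i b h (k | d) hw
      · obtain ⟨q, hq, hx⟩ := att_near i b h _ hw (hgR k)
        exact Or.inl (congrArg _ (hg.inj (hray i b q h hq k hx)))
      · have : p d ∈ polyImage (S y b) ∩ Set.range p := ⟨att_sub i b h hw, ⟨_, rfl⟩⟩
        rw [h₀.meets _ _ (hlr i b h)] at this
        rcases this with e | e
        · exact absurd (h₀.inj e) d.2
        · exact Or.inr (congrArg _ (Subtype.ext (h₀.inj e)))
    rintro (i | b) (j | c) h w hw
    · rcases w with k | d
      · have : g k ∈ polyImage (T i j) ∩ Set.range g := ⟨hw, ⟨_, rfl⟩⟩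
        rw [hg.meets i j h] at this
        exact this.imp (fun e => congrArg _ (hg.inj e)) (fun e => congrArg _ (hg.inj e))
      · exact absurd (hTR i j h hw) (hpR d d.2)
    · exact key i c h w hw
    · rw [psymm _ _ h.symm] at hw
      exact (key j b h.symm w hw).symm
    · rcases w with k | d
      · exact absurd (hgR k) (hSR _ _ (hrr _ _ h) b.2 c.2 _ hw)
      · have : p d ∈ polyImage (S b c) ∩ Set.range p := ⟨hw, ⟨_, rfl⟩⟩
        rw [h₀.meets _ _ (hrr _ _ h)] at this
        exact this.imp (fun e => congrArg _ (Subtype.ext (h₀.inj e)))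
          (fun e => congrArg _ (Subtype.ext (h₀.inj e)))
  have pair : ∀ u v u' v', Γ.Adj u v → Γ.Adj u' v' → s(u, v) ≠ s(u', v') →
      ∀ x ∈ polyImage (E u v), x ∈ polyImage (E u' v') →
        ∃ w, (w = u ∨ w = v) ∧ (w = u' ∨ w = v') ∧ P w = x := by
    have symm₁ : ∀ u v u' v', Γ.Adj u v → (s(u, v) ≠ s(u', v') →
        ∀ x ∈ polyImage (E u v), x ∈ polyImage (E u' v') →
          ∃ w, (w = u ∨ w = v) ∧ (w = u' ∨ w = v') ∧ P w = x) → s(v, u) ≠ s(u', v') →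
        ∀ x ∈ polyImage (E v u), x ∈ polyImage (E u' v') →
          ∃ w, (w = v ∨ w = u) ∧ (w = u' ∨ w = v') ∧ P w = x := by
      intro u v u' v' h hyp hne x hx hx'
      obtain ⟨w, h1, h2⟩ := hyp (by rwa [Sym2.eq_swap]) x (by rwa [← psymm u v h]) hx'
      exact ⟨w, h1.symm, h2⟩
    have symm₂ : ∀ u v u' v', (s(u, v) ≠ s(u', v') →
        ∀ x ∈ polyImage (E u v), x ∈ polyImage (E u' v') →
          ∃ w, (w = u ∨ w = v) ∧ (w = u' ∨ w = v') ∧ P w = x) → s(u', v') ≠ s(u, v) →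
        ∀ x ∈ polyImage (E u' v'), x ∈ polyImage (E u v) →
          ∃ w, (w = u' ∨ w = v') ∧ (w = u ∨ w = v) ∧ P w = x := by
      intro u v u' v' hyp hne x hx hx'
      obtain ⟨w, h1, h2, h3⟩ := hyp hne.symm x hx' hx
      exact ⟨w, h2, h1, h3⟩
    have key₁ : ∀ i j i' j', Γ.Adj (.inl i) (.inl j) → Γ.Adj (.inl i') (.inl j') →
        s(.inl i, .inl j) ≠ s((.inl i' : κ ⊕ {b : W // b ≠ y}), .inl j') →
        ∀ x ∈ polyImage (E (.inl i) (.inl j)), x ∈ polyImage (E (.inl i') (.inl j')) →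
        ∃ w, (w = .inl i ∨ w = .inl j) ∧ (w = .inl i' ∨ w = .inl j') ∧ P w = x := by
      intro i j i' j' h h' hne x hx hx'
      have : x ∈ polyImage (T i j) ∩ polyImage (T i' j') := ⟨hx, hx'⟩
      rw [hg.pair i j i' j' h h' (fun e => hne (congrArg (Sym2.map Sum.inl) e))] at this
      obtain ⟨w, ⟨h1, h2⟩, h3⟩ := this
      exact ⟨.inl w, h1.imp (congrArg _) (congrArg _), h2.imp (congrArg _) (congrArg _), h3⟩
    have key₂ : ∀ i j k b, Γ.Adj (.inl i) (.inl j) → Γ.Adj (.inl k) (.inr b) →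
        ∀ x ∈ polyImage (E (.inl i) (.inl j)), x ∈ polyImage (E (.inl k) (.inr b)) →
        ∃ w, (w = .inl i ∨ w = .inl j) ∧ (w = .inl k ∨ w = .inr b) ∧ P w = x := by
      intro i j k b h h' x hx hx'
      obtain ⟨q, hq, hxs⟩ := att_near k b h' x hx' (hTR i j h hx)
      have e := hray' k b q h' hq i j h x hx hxs
      subst e
      exact ⟨.inl k, meets _ _ h (.inl k) hx, Or.inl rfl, rfl⟩
    have key₃ : ∀ i j b c, Γ.Adj (.inl i) (.inl j) → Γ.Adj (.inr b) (.inr c) →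
        ∀ x ∈ polyImage (E (.inl i) (.inl j)), x ∈ polyImage (E (.inr b) (.inr c)) →
        ∃ w, (w = .inl i ∨ w = .inl j) ∧ (w = .inr b ∨ w = .inr c) ∧ P w = x := by
      intro i j b c h h' x hx hx'
      exact absurd (hTR i j h hx) (hSR _ _ (hrr _ _ h') b.2 c.2 x hx')
    have key₄ : ∀ i b j c, Γ.Adj (.inl i) (.inr b) → Γ.Adj (.inl j) (.inr c) →
        s(.inl i, .inr b) ≠ s((.inl j : κ ⊕ {b : W // b ≠ y}), .inr c) →
        ∀ x ∈ polyImage (E (.inl i) (.inr b)), x ∈ polyImage (E (.inl j) (.inr c)) →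
        ∃ w, (w = .inl i ∨ w = .inr b) ∧ (w = .inl j ∨ w = .inr c) ∧ P w = x := by
      intro i b j c h h' hne x hx hx'
      have hbc : b ≠ c := by
        rintro rfl
        exact hne (by rw [huniq' i j b h h'])
      have : x ∈ polyImage (S y b) ∩ polyImage (S y c) := ⟨att_sub i b h hx, att_sub j c h' hx'⟩
      rw [h₀.pair _ _ _ _ (hlr i b h) (hlr j c h')] at this
      · obtain ⟨w, ⟨h1, h2⟩, rfl⟩ := this
        rcases h1 with rfl | rfl
        · exact absurd hx (att_not i b h)
        · rcases h2 with e | e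
          · exact absurd e b.2
          · exact absurd (Subtype.ext e) hbc
      · intro e
        rcases Sym2.eq_iff.1 e with e | e
        · exact hbc (Subtype.ext e.2)
        · exact c.2 e.1.symm
    have key₅ : ∀ i b c d, Γ.Adj (.inl i) (.inr b) → Γ.Adj (.inr c) (.inr d) →
        ∀ x ∈ polyImage (E (.inl i) (.inr b)), x ∈ polyImage (E (.inr c) (.inr d)) →
        ∃ w, (w = .inl i ∨ w = .inr b) ∧ (w = .inr c ∨ w = .inr d) ∧ P w = x := by
      intro i b c d h h' x hx hx'
      have : x ∈ polyImage (S y b) ∩ polyImage (S c d) := ⟨att_sub i b h hx, hx'⟩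
      rw [h₀.pair _ _ _ _ (hlr i b h) (hrr c d h')] at this
      · obtain ⟨w, ⟨h1, h2⟩, rfl⟩ := this
        rcases h1 with rfl | rfl
        · exact absurd hx (att_not i b h)
        · exact ⟨.inr b, Or.inr rfl, h2.imp (fun e => congrArg _ (Subtype.ext e))
            (fun e => congrArg _ (Subtype.ext e)), rfl⟩
      · intro e
        rcases Sym2.eq_iff.1 e with e | e
        · exact c.2 e.1.symm
        · exact d.2 e.1.symm
    have key₆ : ∀ a b c d, Γ.Adj (.inr a) (.inr b) → Γ.Adj (.inr c) (.inr d) →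
        s(.inr a, .inr b) ≠ s((.inr c : κ ⊕ {b : W // b ≠ y}), .inr d) →
        ∀ x ∈ polyImage (E (.inr a) (.inr b)), x ∈ polyImage (E (.inr c) (.inr d)) →
        ∃ w, (w = .inr a ∨ w = .inr b) ∧ (w = .inr c ∨ w = .inr d) ∧ P w = x := by
      intro a b c d h h' hne x hx hx'
      have : x ∈ polyImage (S a b) ∩ polyImage (S c d) := ⟨hx, hx'⟩
      rw [h₀.pair _ _ _ _ (hrr _ _ h) (hrr _ _ h')] at this
      · obtain ⟨w, ⟨h1, h2⟩, rfl⟩ := this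
        rcases h1 with rfl | rfl
        · exact ⟨.inr a, Or.inl rfl, h2.imp (fun e => congrArg _ (Subtype.ext e))
            (fun e => congrArg _ (Subtype.ext e)), rfl⟩
        · exact ⟨.inr b, Or.inr rfl, h2.imp (fun e => congrArg _ (Subtype.ext e))
            (fun e => congrArg _ (Subtype.ext e)), rfl⟩
      · intro e
        apply hne
        rcases Sym2.eq_iff.1 e with e | e
        · rw [Subtype.ext e.1, Subtype.ext e.2]
        · rw [Subtype.ext e.1, Subtype.ext e.2, Sym2.eq_swap]
    have left : ∀ u v i' j', Γ.Adj u v → Γ.Adj (.inl i') (.inl j') →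
        s(u, v) ≠ s(.inl i', .inl j') →
        ∀ x ∈ polyImage (E u v), x ∈ polyImage (E (.inl i') (.inl j')) →
          ∃ w, (w = u ∨ w = v) ∧ (w = .inl i' ∨ w = .inl j') ∧ P w = x := by
      rintro (i | b) (j | c) i' j' h h'
      · exact key₁ i j i' j' h h'
      · exact symm₂ _ _ _ _ fun _ => key₂ i' j' i c h' h
      · exact symm₁ _ _ _ _ h.symm (symm₂ _ _ _ _ fun _ => key₂ i' j' j b h' h.symm)
      · exact symm₂ _ _ _ _ fun _ => key₃ i' j' b c h' h
    have middle : ∀ u v i' c', Γ.Adj u v → Γ.Adj (.inl i') (.inr c') →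
        s(u, v) ≠ s(.inl i', .inr c') →
        ∀ x ∈ polyImage (E u v), x ∈ polyImage (E (.inl i') (.inr c')) →
          ∃ w, (w = u ∨ w = v) ∧ (w = .inl i' ∨ w = .inr c') ∧ P w = x := by
      rintro (i | b) (j | c) i' c' h h'
      · exact fun _ => key₂ i j i' c' h h'
      · exact key₄ i c i' c' h h'
      · exact symm₁ _ _ _ _ h.symm (key₄ j b i' c' h.symm h')
      · exact symm₂ _ _ _ _ fun _ => key₅ i' c' b c h' h
    rintro u v (i' | b') (j' | c') h h'
    · exact left u v i' j' h h'
    · exact middle u v i' c' h h'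
    · exact symm₂ _ _ _ _ (symm₁ _ _ _ _ h'.symm (symm₂ _ _ _ _ (middle u v j' b' h h'.symm)))
    · rcases u with i | b <;> rcases v with j | c
      · exact fun _ => key₃ i j b' c' h h'
      · exact fun _ => key₅ i c b' c' h h'
      · exact symm₁ _ _ _ _ h.symm fun _ => key₅ j b b' c' h.symm h'
      · exact key₆ b c b' c' h h'
  refine ⟨inj, head, symm, simple, ?_, ?_, length, bend, star⟩
  · intro u v h
    refine Set.Subset.antisymm ?_ ?_
    · rintro _ ⟨hx, ⟨w, rfl⟩⟩
      exact (meets u v h w hx).imp (congrArg _) (congrArg _)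
    · rintro x (rfl | rfl)
      · exact ⟨left_mem u v h, ⟨u, rfl⟩⟩
      · exact ⟨psymm u v h ▸ left_mem v u h.symm, ⟨v, rfl⟩⟩
  · intro u v u' v' h h' hne
    have mem : ∀ u v, Γ.Adj u v → ∀ w, w = u ∨ w = v → P w ∈ polyImage (E u v) := by
      rintro u v h w (rfl | rfl)
      · exact left_mem _ _ h
      · exact psymm u w h ▸ left_mem w u h.symm
    refine Set.Subset.antisymm ?_ ?_
    · rintro x ⟨hx, hx'⟩
      obtain ⟨w, h1, h2, h3⟩ := pair u v u' v' h h' hne x hx hx'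
      exact ⟨w, ⟨h1, h2⟩, h3⟩
    · rintro _ ⟨w, ⟨h1, h2⟩, rfl⟩
      exact ⟨mem u v h w h1, mem u' v' h' w h2⟩

/-! ### Gadgets -/

theorem convex_open_halfSpace_or_eq (f : Pt →ₗ[ℝ] ℝ) (v : Pt) :
    Convex ℝ {x | f x < f v ∨ x = v} := by
  intro x hx z hz a b ha hb hab
  obtain rfl : b = 1 - a := by linarith
  simp only [Set.mem_ofPred_eq, map_add, map_smul, smul_eq_mul] at hx hz ⊢
  rcases eq_or_lt_of_le ha with rfl | ha
  · simpa using hz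
  rcases eq_or_lt_of_le hb with hb | hb
  · obtain rfl : a = 1 := by linarith
    simpa using hx
  rcases hx with hx | rfl
  · left
    have : f z ≤ f v := hz.elim le_of_lt (fun h => h ▸ le_rfl)
    nlinarith [mul_pos ha (sub_pos.2 hx), mul_nonneg hb.le (sub_nonneg.2 this)]
  · rcases hz with hz | rfl
    · left
      nlinarith [mul_pos hb (sub_pos.2 hz)]
    · right
      module

/-- The polylines with two bends per edge, where the edge from `i` to `j` leaves `i` towards the
bend `n i j`. -/
def twoBendSeq {κ : Type*} (g : κ → Pt) (n : κ → κ → Pt) (i j : κ) : List Pt :=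
  [g i, n i j, n j i, g j]

/-- At the vertex `i` of the drawing with vertices `g` and first bends `n`, a further edge can leave
in direction `δ`, away from the origin, without meeting the rest of the drawing. -/
structure IsPort {κ : Type*} (H : SimpleGraph κ) (g : κ → Pt) (n : κ → κ → Pt) (θ : ℝ) (i : κ)
    (δ : Pt) : Prop where
  pos : ∃ r : ℝ, 0 < r ∧ g i = r • δ
  vertex_lt : ∀ j, j ≠ i → inner ℝ δ (g j) < inner ℝ δ (g i)
  bend_lt : ∀ j k, H.Adj j k → inner ℝ δ (n j k) < inner ℝ δ (g i)
  angle_le : ∀ j, H.Adj i j → θ ≤ angle (n i j - g i) δ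

theorem IsPort.polyImage {κ : Type*} {H : SimpleGraph κ} {g : κ → Pt} {n : κ → κ → Pt} {θ : ℝ}
    {i : κ} {δ : Pt} (h : IsPort H g n θ i δ) {j k : κ} (hjk : H.Adj j k) {x : Pt}
    (hx : x ∈ polyImage (twoBendSeq g n j k)) : inner ℝ δ x < inner ℝ δ (g i) ∨ x = g i := by
  have hv : ∀ j, inner ℝ δ (g j) < inner ℝ δ (g i) ∨ g j = g i := fun j => by
    by_cases hji : j = i
    · exact Or.inr (congrArg g hji)
    · exact Or.inl (h.vertex_lt j hji)
  refine polyImage_subset_of_convex (convex_open_halfSpace_or_eq (innerₛₗ ℝ δ) (g i)) ?_ hx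
  intro q hq
  simp only [twoBendSeq, List.mem_cons, List.not_mem_nil, or_false] at hq
  rcases hq with rfl | rfl | rfl | rfl
  · exact hv j
  · exact Or.inl (h.bend_lt j k hjk)
  · exact Or.inl (h.bend_lt k j hjk.symm)
  · exact hv k

theorem IsPort.eq_of_ray {κ : Type*} {H : SimpleGraph κ} {g : κ → Pt} {n : κ → κ → Pt} {θ : ℝ}
    {i : κ} {δ : Pt} (h : IsPort H g n θ i δ) {x : Pt}
    (hx : inner ℝ δ x < inner ℝ δ (g i) ∨ x = g i) {c q : Pt} {ε τ : ℝ} (hε : 0 < ε)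
    {L : Pt ≃ₗᵢ[ℝ] Pt} (hτ : 0 < τ) (hq : q - c = τ • L δ)
    (hseg : similarity c ε L x ∈ segment ℝ (similarity c ε L (g i)) q) (t : ℝ) (ht1 : t < 1)
    (ht : similarity c ε L (g i) = c + t • (q - c)) : x = g i := by
  refine hx.resolve_left fun hlt => ?_
  obtain ⟨r, hr, hgi⟩ := h.pos
  rw [segment_eq_image'] at hseg
  obtain ⟨s, ⟨hs0, hs1⟩, hs⟩ := hseg
  have hs' : similarity c ε L (g i) + s • (q - similarity c ε L (g i)) = similarity c ε L x := hs
  have e : ε • L (x - g i) = (s * (1 - t) * τ) • L δ := by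
    have h1 : ε • L (x - g i) = similarity c ε L x - similarity c ε L (g i) := by
      simp only [similarity, map_sub]
      module
    rw [h1, ← hs', ht, mul_smul, ← hq]
    module
  have e' : x - g i = (ε⁻¹ * (s * (1 - t) * τ)) • δ := by
    apply L.injective
    rw [map_smul, mul_smul, ← e, inv_smul_smul₀ hε.ne']
  have : inner ℝ δ (x - g i) = ε⁻¹ * (s * (1 - t) * τ) * inner ℝ δ δ := by
    rw [e', inner_smul_right]
  rw [inner_sub_right] at this
  have h0 : 0 ≤ ε⁻¹ * (s * (1 - t) * τ) * inner ℝ δ δ := by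
    have := sub_pos.2 ht1
    have := real_inner_self_nonneg (x := δ)
    positivity
  linarith

theorem IsGoodDrawing.exists_clear_ball {W : Type*} [Finite W] {Γ : SimpleGraph W} {p : W → Pt}
    {S : W → W → List Pt} {θ : ℝ} (h : IsGoodDrawing Γ p S θ) (y : W) :
    ∃ R : ℝ, 0 < R ∧ (∀ b, b ≠ y → p b ∉ Metric.ball (p y) R) ∧
      (∀ a b, Γ.Adj a b → a ≠ y → b ≠ y → ∀ x ∈ polyImage (S a b), x ∉ Metric.ball (p y) R) ∧
      (∀ b, Γ.Adj y b → ∀ x ∈ polyImage (S y b).tail, x ∉ Metric.ball (p y) R) := by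
  set F : Set Pt := (⋃ b : W, ⋃ _ : b ≠ y, {p b}) ∪
    ((⋃ a : W, ⋃ b : W, ⋃ _ : Γ.Adj a b ∧ a ≠ y ∧ b ≠ y, polyImage (S a b)) ∪
      ⋃ b : W, ⋃ _ : Γ.Adj y b, polyImage (S y b).tail) with hF
  have hclosed : IsClosed F := by
    refine IsClosed.union ?_ (IsClosed.union ?_ ?_)
    · exact isClosed_iUnion_of_finite fun b => isClosed_iUnion_of_finite fun _ =>
        isClosed_singleton
    · exact isClosed_iUnion_of_finite fun a => isClosed_iUnion_of_finite fun b =>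
        isClosed_iUnion_of_finite fun _ => isClosed_polyImage _
    · exact isClosed_iUnion_of_finite fun b => isClosed_iUnion_of_finite fun _ =>
        isClosed_polyImage _
  have hy : p y ∈ Fᶜ := by
    rintro (hx | hx | hx)
    · simp only [Set.mem_iUnion, Set.mem_singleton_iff] at hx
      obtain ⟨b, hb, e⟩ := hx
      exact hb (h.inj e.symm)
    · simp only [Set.mem_iUnion] at hx
      obtain ⟨a, b, ⟨hab, ha, hb⟩, hx⟩ := hx
      have : p y ∈ polyImage (S a b) ∩ Set.range p := ⟨hx, ⟨y, rfl⟩⟩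
      rw [h.meets a b hab] at this
      rcases this with e | e
      · exact ha (h.inj e.symm)
      · exact hb (h.inj e.symm)
    · simp only [Set.mem_iUnion] at hx
      obtain ⟨b, hb, hx⟩ := hx
      obtain ⟨q, l, hS⟩ := h.exists_eq_cons_cons hb
      have hs := h.simple _ _ hb
      rw [hS] at hs hx
      obtain ⟨h1, h2, -⟩ := simplePolyline_cons_cons.1 hs
      exact h1 (h2 ⟨left_mem_segment ℝ _ _, hx⟩)
  obtain ⟨R, hR, hball⟩ := Metric.isOpen_iff.1 hclosed.isOpen_compl _ hy
  refine ⟨R, hR, fun b hb hx => hball hx ?_, fun a b hab ha hb x hx hx' => hball hx' ?_,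
    fun b hb x hx hx' => hball hx' ?_⟩
  · left
    simp only [Set.mem_iUnion]
    exact ⟨b, hb, rfl⟩
  · right; left
    simp only [Set.mem_iUnion]
    exact ⟨a, b, ⟨hab, ha, hb⟩, hx⟩
  · right; right
    simp only [Set.mem_iUnion]
    exact ⟨b, hb, hx⟩

theorem exists_norm_bound {κ : Type*} [Finite κ] (g : κ → Pt) (n : κ → κ → Pt) :
    ∃ M : ℝ, 0 ≤ M ∧ ∀ i j, ∀ x ∈ twoBendSeq g n i j, ‖x‖ ≤ M := by
  have hfin : (⋃ i : κ, ⋃ j : κ, {x | x ∈ twoBendSeq g n i j}).Finite :=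
    Set.finite_iUnion fun i => Set.finite_iUnion fun j => List.finite_toSet _
  obtain ⟨M, hM⟩ := hfin.isBounded.exists_norm_le
  refine ⟨max M 0, le_max_right _ _, fun i j x hx => (hM x ?_).trans (le_max_left _ _)⟩
  simp only [Set.mem_iUnion]
  exact ⟨i, j, hx⟩

/-- Blowing up the vertex `y` of a drawing into a gadget, on the sum type. -/
theorem IsGoodDrawing.blowUp_gadget {κ W : Type*} [Finite κ] [Finite W] {Γ₀ : SimpleGraph W}
    {p : W → Pt} {S : W → W → List Pt} {θ : ℝ} (h₀ : IsGoodDrawing Γ₀ p S θ) {y : W}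
    {Γ : SimpleGraph (κ ⊕ {b : W // b ≠ y})} {g : κ → Pt} {n : κ → κ → Pt}
    {H : SimpleGraph κ} (hg : IsGoodDrawing H g (twoBendSeq g n) θ)
    (hll : ∀ i j, Γ.Adj (.inl i) (.inl j) → H.Adj i j)
    (hrr : ∀ b c, Γ.Adj (.inr b) (.inr c) → Γ₀.Adj b c)
    (hlr : ∀ i b, Γ.Adj (.inl i) (.inr b) → Γ₀.Adj y b)
    (huniq : ∀ i b c, Γ.Adj (.inl i) (.inr b) → Γ.Adj (.inl i) (.inr c) → b = c)
    (huniq' : ∀ i j b, Γ.Adj (.inl i) (.inr b) → Γ.Adj (.inl j) (.inr b) → i = j)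
    (L : Pt ≃ₗᵢ[ℝ] Pt) (δ : κ → Pt)
    (hport : ∀ i b, Γ.Adj (.inl i) (.inr b) → IsPort H g n θ i (δ i))
    (hdir : ∀ i b q, Γ.Adj (.inl i) (.inr b) → (S y b)[1]? = some q →
      ∃ t : ℝ, 0 < t ∧ q - p y = t • L (δ i)) :
    HasGoodDrawing Γ θ := by
  obtain ⟨R, hR, hpR, hSR, hSR'⟩ := h₀.exists_clear_ball y
  obtain ⟨M, hM, hgM⟩ := exists_norm_bound g n
  have hM1 : 0 < M + 1 := by linarith
  set ε : ℝ := R / (M + 1) with hεdef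
  have hε : 0 < ε := by positivity
  set f := similarity (p y) ε L with hf
  have hball : ∀ x, ‖x‖ ≤ M → f x ∈ Metric.ball (p y) R := by
    intro x hx
    have : f x - p y = ε • L x := add_sub_cancel_left _ _
    rw [Metric.mem_ball, dist_eq_norm, this, norm_smul, L.norm_map, Real.norm_of_nonneg hε.le,
      hεdef, div_mul_eq_mul_div, div_lt_iff₀ hM1]
    exact mul_lt_mul_of_pos_left (by linarith) hR
  have hqR : ∀ b q, Γ₀.Adj y b → (S y b)[1]? = some q → q ∉ Metric.ball (p y) R := by
    intro b q hb hq
    obtain ⟨q', l, hS⟩ := h₀.exists_eq_cons_cons hb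
    have hlast := h₀.last hb
    rw [hS] at hq hlast
    obtain rfl : q' = q := by simpa using hq
    cases l with
    | nil =>
      obtain rfl : q' = p b := by simpa using hlast
      exact hpR b hb.ne'
    | cons z l =>
      refine hSR' b hb _ ?_
      rw [hS]
      exact mem_polyImage_of_mem (by simp) (by simp)
  have hpos : ∀ i b q, Γ.Adj (.inl i) (.inr b) → (S y b)[1]? = some q →
      ∃ t : ℝ, 0 < t ∧ t < 1 ∧ f (g i) = p y + t • (q - p y) := by
    intro i b q hib hq
    obtain ⟨τ, hτ, hqd⟩ := hdir i b q hib hq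
    obtain ⟨r, hr, hgi⟩ := (hport i b hib).pos
    refine ⟨ε * r / τ, by positivity, ?_, ?_⟩
    · rw [div_lt_one hτ]
      have h1 := hqR b q (hlr i b hib) hq
      have h2 := hball (g i) (hgM i i _ (by simp [twoBendSeq]))
      have e : f (g i) - p y = (ε * r) • L (δ i) := by
        rw [hf, similarity, add_sub_cancel_left, hgi, map_smul, smul_smul]
      rw [Metric.mem_ball, dist_eq_norm] at h1 h2
      rw [e, norm_smul, Real.norm_of_nonneg (by positivity)] at h2
      rw [hqd, norm_smul, Real.norm_of_nonneg hτ.le, not_lt] at h1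
      exact lt_of_mul_lt_mul_right (h2.trans_le h1) (norm_nonneg _)
    · rw [hqd, smul_smul, div_mul_cancel₀ _ hτ.ne', hf, similarity, hgi, map_smul, smul_smul]
  have hgood := (hg.comap id Function.injective_id hll (Γ' := Γ.comap Sum.inl)).map
    (similarity_injective (p y) hε L) (similarity_image_segment (p y) ε L)
    (similarity_angle (p y) hε L)
  refine ⟨_, _, h₀.blowUp hgood hrr hlr huniq huniq' hR ?_ ?_ hpR hSR hSR' hpos ?_ ?_ ?_⟩
  · exact fun j => hball _ (hgM j j _ (by simp [twoBendSeq]))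
  · intro j k hjk
    rw [polyImage_map (similarity_image_segment _ _ _)]
    rintro _ ⟨x, hx, rfl⟩
    refine hball x ?_
    have := polyImage_subset_of_convex (convex_closedBall (0 : Pt) M)
      (fun q hq => by simpa using hgM j k q hq) hx
    simpa using this
  · intro i b q hib hq j hj
    obtain ⟨τ, hτ, hqd⟩ := hdir i b q hib hq
    obtain ⟨t, -, ht1, ht⟩ := hpos i b q hib hq
    refine congrArg f ((hport i b hib).eq_of_ray ?_ hε hτ hqd hj t ht1 ht)
    by_cases hji : j = i
    · exact Or.inr (congrArg g hji)
    · exact Or.inl ((hport i b hib).vertex_lt j hji)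
  · intro i b q hib hq j k hjk x hx hxs
    obtain ⟨τ, hτ, hqd⟩ := hdir i b q hib hq
    obtain ⟨t, -, ht1, ht⟩ := hpos i b q hib hq
    rw [polyImage_map (similarity_image_segment _ _ _)] at hx
    obtain ⟨x, hx, rfl⟩ := hx
    exact congrArg f ((hport i b hib).eq_of_ray ((hport i b hib).polyImage (hll _ _ hjk) hx)
      hε hτ hqd hxs t ht1 ht)
  · intro i b q hib hq j hij a ha
    obtain ⟨τ, hτ, hqd⟩ := hdir i b q hib hq
    obtain ⟨t, ht0, ht1, ht⟩ := hpos i b q hib hq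
    obtain rfl : f (n i j) = a := by simpa [twoBendSeq] using ha
    have e1 : f (n i j) - f (g i) = ε • L (n i j - g i) := by
      simp only [hf, similarity, map_sub]
      module
    have e2 : q - f (g i) = ((1 - t) * τ) • L (δ i) := by
      rw [ht, mul_smul, ← hqd]
      module
    have : 0 < (1 - t) * τ := mul_pos (by linarith) hτ
    change θ ≤ angle (f (n i j) - f (g i)) (q - f (g i))
    rw [e1, e2, angle_smul_left_of_pos _ _ hε, angle_smul_right_of_pos _ _ this]
    exact ((hport i b hib).angle_le j (hll _ _ hij)).trans
      (L.toLinearIsometry.angle_map _ _).ge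

/-- Replacing the vertex `y` of a drawing of `Γ₀` by a gadget gives a drawing of `Γ`, where the
gadget is embedded into `Γ` by `ι` and the rest of `Γ` is mapped to `Γ₀` by `ψ`. -/
theorem IsGoodDrawing.hasGoodDrawing_of_gadget {κ W W' : Type*} [Finite κ] [Finite W]
    {Γ₀ : SimpleGraph W} {p : W → Pt} {S : W → W → List Pt} {θ : ℝ}
    (h₀ : IsGoodDrawing Γ₀ p S θ) {y : W} {Γ : SimpleGraph W'} {ι : κ → W'}
    {ψ : W' → W} (hψy : ∀ a, a ∉ Set.range ι → ψ a ≠ y)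
    (hψ : ∀ a b, a ∉ Set.range ι → b ∉ Set.range ι → ψ a = ψ b → a = b)
    (hrr : ∀ a b, a ∉ Set.range ι → b ∉ Set.range ι → Γ.Adj a b → Γ₀.Adj (ψ a) (ψ b))
    (hlr : ∀ i a, a ∉ Set.range ι → Γ.Adj (ι i) a → Γ₀.Adj y (ψ a))
    (huniq : ∀ i a b, a ∉ Set.range ι → b ∉ Set.range ι → Γ.Adj (ι i) a → Γ.Adj (ι i) b → a = b)
    (huniq' : ∀ i j a, a ∉ Set.range ι → Γ.Adj (ι i) a → Γ.Adj (ι j) a → i = j)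
    {H : SimpleGraph κ} (hll : ∀ i j, Γ.Adj (ι i) (ι j) → H.Adj i j)
    {g : κ → Pt} {n : κ → κ → Pt} (hg : IsGoodDrawing H g (twoBendSeq g n) θ)
    (L : Pt ≃ₗᵢ[ℝ] Pt) (δ : κ → Pt)
    (hport : ∀ i a, a ∉ Set.range ι → Γ.Adj (ι i) a → IsPort H g n θ i (δ i))
    (hdir : ∀ i a, a ∉ Set.range ι → Γ.Adj (ι i) a → ∀ q, (S y (ψ a))[1]? = some q →
      ∃ t : ℝ, 0 < t ∧ q - p y = t • L (δ i)) :
    HasGoodDrawing Γ θ := by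
  classical
  let f : W' → κ ⊕ {b : W // b ≠ y} := fun a =>
    if h : a ∈ Set.range ι then .inl h.choose else .inr ⟨ψ a, hψy a h⟩
  have fl : ∀ a i, f a = .inl i → a = ι i := by
    intro a i h
    by_cases ha : a ∈ Set.range ι
    · simp only [f, dif_pos ha, Sum.inl.injEq] at h
      rw [← h, ha.choose_spec]
    · simp only [f, dif_neg ha, reduceCtorEq] at h
  have fr : ∀ a b, f a = .inr b → a ∉ Set.range ι ∧ ψ a = b := by
    intro a b h
    by_cases ha : a ∈ Set.range ι
    · simp only [f, dif_pos ha, reduceCtorEq] at h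
    · simp only [f, dif_neg ha, Sum.inr.injEq] at h
      exact ⟨ha, by rw [← h]⟩
  have finj : Function.Injective f := by
    intro a b hab
    rcases hb : f b with i | c
    · rw [fl a i (hab.trans hb), fl b i hb]
    · obtain ⟨h1, h2⟩ := fr a c (hab.trans hb)
      obtain ⟨h3, h4⟩ := fr b c hb
      exact hψ a b h1 h3 (h2.trans h4.symm)
  let Γ' : SimpleGraph (κ ⊕ {b : W // b ≠ y}) := Γ.map (⟨f, finj⟩ : W' ↪ _)
  have adj : ∀ u v, Γ'.Adj u v → ∃ a b, Γ.Adj a b ∧ f a = u ∧ f b = v := by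
    intro u v h
    exact (SimpleGraph.map_adj (⟨f, finj⟩ : W' ↪ _) Γ u v).1 h
  have hl : ∀ i b, Γ'.Adj (.inl i) (.inr b) → ∃ a, a ∉ Set.range ι ∧ Γ.Adj (ι i) a ∧ ψ a = b := by
    intro i b h
    obtain ⟨a, c, hac, ha, hc⟩ := adj _ _ h
    obtain rfl := fl a i ha
    exact ⟨c, (fr c b hc).1, hac, (fr c b hc).2⟩
  obtain ⟨P, E, hPE⟩ : HasGoodDrawing Γ' θ := by
    refine h₀.blowUp_gadget hg ?_ ?_ ?_ ?_ ?_ L δ ?_ ?_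
    · intro i j h
      obtain ⟨a, b, hab, ha, hb⟩ := adj _ _ h
      rw [fl a i ha, fl b j hb] at hab
      exact hll i j hab
    · intro b c h
      obtain ⟨a, d, had, ha, hd⟩ := adj _ _ h
      obtain ⟨h1, h2⟩ := fr _ _ ha
      obtain ⟨h3, h4⟩ := fr _ _ hd
      rw [← h2, ← h4]
      exact hrr a d h1 h3 had
    · intro i b h
      obtain ⟨a, h1, h2, h3⟩ := hl i b h
      exact h3 ▸ hlr i a h1 h2
    · intro i b c h h'
      obtain ⟨a, h1, h2, h3⟩ := hl i b h
      obtain ⟨a', h1', h2', h3'⟩ := hl i c h'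
      refine Subtype.ext ?_
      rw [← h3, ← h3', huniq i a a' h1 h1' h2 h2']
    · intro i j b h h'
      obtain ⟨a, h1, h2, h3⟩ := hl i b h
      obtain ⟨a', h1', h2', h3'⟩ := hl j b h'
      obtain rfl := hψ a a' h1 h1' (h3.trans h3'.symm)
      exact huniq' i j a h1 h2 h2'
    · intro i b h
      obtain ⟨a, h1, h2, -⟩ := hl i b h
      exact hport i a h1 h2
    · intro i b q h hq
      obtain ⟨a, h1, h2, h3⟩ := hl i b h
      exact hdir i a h1 h2 q (by rwa [h3])
  refine ⟨_, _, hPE.comap f finj fun a b hab => ?_⟩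
  exact (SimpleGraph.map_adj (⟨f, finj⟩ : W' ↪ _) Γ _ _).2 ⟨a, b, hab, rfl, rfl⟩

/-- The path with vertices `a`, `b` and bends `m`, `m'` is monotone in some direction, its two
bends have angle at least `θ`, and all its points except `a` and `b` satisfy `P` since they are
contained in an intersection of open half-spaces on which `P` holds. -/
structure IsGoodPath (a m m' b : Pt) (θ : ℝ) (P : Pt → Prop) : Prop where
  mono : ∃ f : Pt →ₗ[ℝ] ℝ, f a < f m ∧ f m < f m' ∧ f m' < f b
  left : θ ≤ angle (a - m) (m' - m)
  right : θ ≤ angle (b - m') (m - m')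
  region : ∃ C : List (Pt × ℝ), (∀ h ∈ C, h.2 ≤ inner ℝ h.1 a ∧ h.2 < inner ℝ h.1 m ∧
    h.2 < inner ℝ h.1 m' ∧ h.2 ≤ inner ℝ h.1 b) ∧ ∀ x, (∀ h ∈ C, h.2 < inner ℝ h.1 x) → P x

theorem lt_inner_combo {v a b : Pt} {d α β : ℝ} (ha : d ≤ inner ℝ v a) (hb : d < inner ℝ v b)
    (hα : 0 ≤ α) (hβ : 0 < β) (hαβ : α + β = 1) : d < inner ℝ v (α • a + β • b) := by
  rw [inner_add_right, inner_smul_right, inner_smul_right]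
  obtain rfl : α = 1 - β := by linarith
  nlinarith [mul_le_mul_of_nonneg_left ha hα, mul_lt_mul_of_pos_left hb hβ]

theorem IsGoodPath.of_mem {a m m' b : Pt} {θ : ℝ} {P : Pt → Prop} (h : IsGoodPath a m m' b θ P)
    {x : Pt} (hx : x ∈ polyImage [a, m, m', b]) : P x ∨ x = a ∨ x = b := by
  obtain ⟨C, hC, hP⟩ := h.region
  simp only [polyImage_cons_cons, polyImage_singleton, Set.union_empty, Set.mem_union] at hx
  rcases hx with ⟨α, β, hα, hβ, hαβ, rfl⟩ | ⟨α, β, hα, hβ, hαβ, rfl⟩ | ⟨α, β, hα, hβ, hαβ, rfl⟩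
  · rcases hβ.eq_or_lt with rfl | hβ
    · exact Or.inr (Or.inl (by simp [show α = 1 by linarith]))
    · exact Or.inl (hP _ fun l hl => lt_inner_combo (hC l hl).1 (hC l hl).2.1 hα hβ hαβ)
  · refine Or.inl (hP _ fun l hl => ?_)
    rcases hβ.eq_or_lt with rfl | hβ
    · simpa [show α = 1 by linarith] using (hC l hl).2.1
    · exact lt_inner_combo (hC l hl).2.1.le (hC l hl).2.2.1 hα hβ hαβ
  · rcases hα.eq_or_lt with rfl | hα
    · exact Or.inr (Or.inr (by simp [show β = 1 by linarith]))
    · refine Or.inl (hP _ fun l hl => ?_)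
      rw [add_comm]
      exact lt_inner_combo (hC l hl).2.2.2 (hC l hl).2.2.1 hβ hα (by linarith)

theorem IsGoodPath.simplePolyline {a m m' b : Pt} {θ : ℝ} {P : Pt → Prop}
    (h : IsGoodPath a m m' b θ P) : SimplePolyline [a, m, m', b] := by
  obtain ⟨f, h1, h2, h3⟩ := h.mono
  refine simplePolyline_of_strictMono f ?_
  simp only [List.pairwise_cons, List.mem_cons, List.not_mem_nil, or_false, forall_eq_or_imp,
    forall_eq, List.Pairwise.nil, and_true, false_imp_iff, implies_true]
  exact ⟨⟨h1, h1.trans h2, (h1.trans h2).trans h3⟩, ⟨h2, h2.trans h3⟩, h3⟩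

theorem IsGoodPath.symm {a m m' b : Pt} {θ : ℝ} {P : Pt → Prop} (h : IsGoodPath a m m' b θ P) :
    IsGoodPath b m' m a θ P where
  mono := by
    obtain ⟨f, h1, h2, h3⟩ := h.mono
    exact ⟨-f, by simpa using h3, by simpa using h2, by simpa using h1⟩
  left := h.right
  right := h.left
  region := by
    obtain ⟨C, hC, hP⟩ := h.region
    exact ⟨C, fun l hl => ⟨(hC l hl).2.2.2, (hC l hl).2.2.1, (hC l hl).2.1, (hC l hl).1⟩, hP⟩

/-- A criterion for a drawing with two bends per edge to be good: `c` assigns to each point of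
space the edge, if any, to whose region it belongs. -/
theorem isGoodDrawing_twoBendSeq {κ : Type*} [LinearOrder κ] {H : SimpleGraph κ} {g : κ → Pt}
    {n : κ → κ → Pt} {θ : ℝ} (hg : Function.Injective g) (c : Pt → Option (Sym2 κ))
    (hcg : ∀ i, c (g i) = none)
    (hpath : ∀ i j, i < j → H.Adj i j →
      IsGoodPath (g i) (n i j) (n j i) (g j) θ fun x => c x = some s(i, j))
    (hstar : ∀ i j k, j < k → H.Adj i j → H.Adj i k → θ ≤ angle (n i j - g i) (n i k - g i)) :
    IsGoodDrawing H g (twoBendSeq g n) θ := by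
  have hpath' : ∀ i j, H.Adj i j →
      IsGoodPath (g i) (n i j) (n j i) (g j) θ fun x => c x = some s(i, j) := by
    intro i j h
    rcases lt_or_gt_of_ne h.ne with hij | hij
    · exact hpath i j hij h
    · have := (hpath j i hij h.symm).symm
      rwa [Sym2.eq_swap] at this
  have hmem : ∀ i j x, x ∈ polyImage (twoBendSeq g n i j) → H.Adj i j →
      c x = some s(i, j) ∨ x = g i ∨ x = g j := fun i j x hx h => (hpath' i j h).of_mem hx
  have hend : ∀ i j, g i ∈ polyImage (twoBendSeq g n i j) ∧ g j ∈ polyImage (twoBendSeq g n i j) :=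
    fun i j => ⟨mem_polyImage_of_mem (by simp [twoBendSeq]) (by simp [twoBendSeq]),
      mem_polyImage_of_mem (by simp [twoBendSeq]) (by simp [twoBendSeq])⟩
  have hvert : ∀ i j k, g k ∈ polyImage (twoBendSeq g n i j) → H.Adj i j → k = i ∨ k = j := by
    intro i j k hk h
    rcases hmem i j _ hk h with h1 | h1
    · simp [hcg] at h1
    · exact h1.imp (fun e => hg e) (fun e => hg e)
  refine ⟨hg, fun i j _ => rfl, fun i j _ => rfl, fun i j h => (hpath' i j h).simplePolyline,
    ?_, ?_, fun i j _ => le_rfl, ?_, ?_⟩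
  · intro i j h
    refine Set.Subset.antisymm ?_ ?_
    · rintro x ⟨hx, k, rfl⟩
      rcases hvert i j k hx h with rfl | rfl <;> simp
    · rintro x (rfl | rfl)
      · exact ⟨(hend i j).1, i, rfl⟩
      · exact ⟨(hend i j).2, j, rfl⟩
  · intro i j i' j' h h' hne
    refine Set.Subset.antisymm ?_ ?_
    · rintro x ⟨hx, hx'⟩
      have key : ∀ k, x = g k → x ∈ g '' (({i, j} : Set κ) ∩ {i', j'}) := by
        rintro k rfl
        exact ⟨k, ⟨hvert i j k hx h, hvert i' j' k hx' h'⟩, rfl⟩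
      rcases hmem i j x hx h with h1 | h1 | h1
      · rcases hmem i' j' x hx' h' with h2 | h2 | h2
        · exact absurd (Option.some_injective _ (h1.symm.trans h2)) hne
        · exact key _ h2
        · exact key _ h2
      · exact key _ h1
      · exact key _ h1
    · rintro _ ⟨k, ⟨hk, hk'⟩, rfl⟩
      refine ⟨?_, ?_⟩
      · rcases hk with rfl | rfl
        exacts [(hend _ _).1, (hend _ _).2]
      · rcases hk' with rfl | rfl
        exacts [(hend _ _).1, (hend _ _).2]
  · intro i j h a q b hq
    have := hpath' i j h
    simp only [twoBendSeq, List.infix_cons_iff, List.cons_prefix_cons, List.nil_prefix,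
      List.infix_nil, and_true, List.prefix_nil, reduceCtorEq, and_false, or_false] at hq
    rcases hq with ⟨rfl, rfl, rfl⟩ | ⟨rfl, rfl, rfl⟩
    · exact this.left
    · rw [angle_comm]
      exact this.right
  · intro i j k hj hk hjk a b ha hb
    obtain rfl : n i j = a := by simpa [twoBendSeq] using ha
    obtain rfl : n i k = b := by simpa [twoBendSeq] using hb
    rcases lt_or_gt_of_ne hjk with h | h
    · exact hstar i j k h hj hk
    · rw [angle_comm]
      exact hstar i k j h hk hj

theorem two_pi_div_three_le_angle {a b : Pt} (h : inner ℝ a b < 0)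
    (h' : ‖a‖ ^ 2 * ‖b‖ ^ 2 ≤ 4 * inner ℝ a b ^ 2) : 2 * Real.pi / 3 ≤ angle a b := by
  have ha : 0 < ‖a‖ := norm_pos_iff.2 (by rintro rfl; simp at h)
  have hb : 0 < ‖b‖ := norm_pos_iff.2 (by rintro rfl; simp at h)
  have hab := mul_pos ha hb
  have hcos : Real.cos (2 * Real.pi / 3) = -1 / 2 := by
    rw [show 2 * Real.pi / 3 = Real.pi - Real.pi / 3 by ring, Real.cos_pi_sub,
      Real.cos_pi_div_three]
    norm_num
  have h0 : 0 ≤ 2 * Real.pi / 3 := by positivity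
  have h1 : 2 * Real.pi / 3 ≤ Real.pi := by linarith [Real.pi_pos]
  rw [angle, ← Real.arccos_cos h0 h1, hcos]
  refine Real.arccos_le_arccos ?_
  rw [div_le_iff₀ hab]
  have : ‖a‖ * ‖b‖ ≤ 2 * -inner ℝ a b := by
    refine abs_le_of_sq_le_sq' ?_ (by linarith) |>.2
    nlinarith
  linarith

theorem inner_le_of_two_pi_div_three_le_angle {a b : Pt} (ha : ‖a‖ = 1) (hb : ‖b‖ = 1)
    (h : 2 * Real.pi / 3 ≤ angle a b) : inner ℝ a b ≤ -1 / 2 := by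
  have h1 := Real.cos_le_cos_of_nonneg_of_le_pi (by positivity) (angle_le_pi a b) h
  rw [cos_angle, ha, hb, show 2 * Real.pi / 3 = Real.pi - Real.pi / 3 by ring, Real.cos_pi_sub,
    Real.cos_pi_div_three] at h1
  linarith

theorem inner_eq_sum (a b : Pt) : inner ℝ a b = a 0 * b 0 + a 1 * b 1 + a 2 * b 2 := by
  simp only [PiLp.inner_apply, Fin.sum_univ_three, RCLike.inner_apply, conj_trivial]
  ring

theorem two_pi_div_three_le_angle_of_coord {a b : Pt} {t r : ℝ} (d e : Pt) (ht : 0 < t)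
    (hr : 0 < r) (ha : a = t • d) (hb : b = r • e) (hd : d 0 ^ 2 + d 1 ^ 2 + d 2 ^ 2 = 1)
    (he : e 0 ^ 2 + e 1 ^ 2 + e 2 ^ 2 = 1) (hde : d 0 * e 0 + d 1 * e 1 + d 2 * e 2 ≤ -1 / 2) :
    2 * Real.pi / 3 ≤ angle a b := by
  rw [ha, hb, angle_smul_left_of_pos _ _ ht, angle_smul_right_of_pos _ _ hr]
  have hn : ∀ v : Pt, ‖v‖ ^ 2 = v 0 ^ 2 + v 1 ^ 2 + v 2 ^ 2 := fun v => by
    simp only [EuclideanSpace.norm_sq_eq, Fin.sum_univ_three, Real.norm_eq_abs, sq_abs]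
  rw [← inner_eq_sum] at hde
  refine two_pi_div_three_le_angle (by linarith) ?_
  rw [hn, hn, hd, he]
  nlinarith

section

/-! ### The triangle gadget -/

theorem two_pi_div_three_le_angle_straight {a b : Pt} {r : ℝ} (hr : r < 0) (ha : a ≠ 0)
    (hb : b = r • a) : 2 * Real.pi / 3 ≤ angle a b := by
  rw [hb, angle_smul_right_of_neg _ _ hr, angle_neg_right, angle_self ha]
  linarith [Real.pi_pos]

variable {k c s : ℝ}

theorem isGoodPath_triangle_top (hk : 0 < k) (hk3 : k ^ 2 = 3) (hc : k / 2 ≤ c) (hs0 : 0 ≤ s)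
    (hs : s ≤ 1 / 2) (h : c ^ 2 + s ^ 2 = 1) {P : Pt → Prop} (hP : ∀ x : Pt, s < x 1 → P x) :
    IsGoodPath !₂[c, s, 0] !₂[(3 * c - k * s) / 4, (3 * s + k * c) / 4, 0]
      !₂[-(3 * c - k * s) / 4, (3 * s + k * c) / 4, 0] !₂[-c, s, 0] (2 * Real.pi / 3) P := by
  have h1 : 1 ≤ c + k * s := by
    nlinarith [mul_nonneg hk.le hs0, mul_nonneg (by linarith : 0 ≤ c) (mul_nonneg hk.le hs0)]
  have h2 : 1 ≤ k * c - s := by nlinarith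
  have h3 : 0 < 3 * c - k * s := by nlinarith
  constructor
  · refine ⟨innerₛₗ ℝ !₂[-1, 0, 0], ?_, ?_, ?_⟩ <;> simp [inner_eq_sum] <;> nlinarith
  · refine two_pi_div_three_le_angle_of_coord (t := 1 / 2) (r := (3 * c - k * s) / 2)
      !₂[(c + k * s) / 2, -(k * c - s) / 2, 0] !₂[-1, 0, 0] (by norm_num)
      (by linarith) ?_ ?_ ?_ ?_ ?_
    · ext i; fin_cases i <;> simp <;> ring
    · ext i; fin_cases i <;> simp; ring
    · simp; nlinarith
    · simp
    · simp; linarith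
  · refine two_pi_div_three_le_angle_of_coord (t := 1 / 2) (r := (3 * c - k * s) / 2)
      !₂[-(c + k * s) / 2, -(k * c - s) / 2, 0] !₂[1, 0, 0] (by norm_num)
      (by linarith) ?_ ?_ ?_ ?_ ?_
    · ext i; fin_cases i <;> simp <;> ring
    · ext i; fin_cases i <;> simp; ring
    · simp; nlinarith
    · simp
    · simp; linarith
  · refine ⟨[(!₂[0, 1, 0], s)], ?_, fun x hx => hP x ?_⟩
    · simp [inner_eq_sum]; nlinarith
    · simpa [inner_eq_sum] using hx

theorem isGoodPath_triangle_side (hk : 0 < k) (hk3 : k ^ 2 = 3) (hc : k / 2 ≤ c) (hs0 : 0 ≤ s)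
    (hs : s ≤ 1 / 2) (h : c ^ 2 + s ^ 2 = 1) {σ : ℝ} (hσ : σ = 1 ∨ σ = -1) {P : Pt → Prop}
    (hP : ∀ x : Pt, x 1 < s → 0 < σ * x 0 → P x) :
    IsGoodPath !₂[σ * c, s, 0] !₂[σ * (c + k * s) / 2, (s - k * c) / 2, 0]
      !₂[σ * (c + k * s) / 4, (s - k * c) / 4 - k * c / 3, 0] !₂[0, -(2 * k * c / 3), 0]
      (2 * Real.pi / 3) P := by
  have h1 : 1 ≤ c + k * s := by
    nlinarith [mul_nonneg hk.le hs0, mul_nonneg (by linarith : 0 ≤ c) (mul_nonneg hk.le hs0)]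
  have h2 : 1 ≤ k * c - s := by nlinarith
  have hσ2 : σ ^ 2 = 1 := by rcases hσ with rfl | rfl <;> norm_num
  constructor
  · refine ⟨innerₛₗ ℝ !₂[0, -1, 0], ?_, ?_, ?_⟩ <;> simp [inner_eq_sum] <;> nlinarith
  · refine two_pi_div_three_le_angle_of_coord (t := 1) (r := (c + k * s) / (2 * k))
      !₂[σ * (c - k * s) / 2, (s + k * c) / 2, 0] !₂[-σ * k / 2, -1 / 2, 0] (by norm_num)
      (by positivity) ?_ ?_ ?_ ?_ ?_
    · ext i; fin_cases i <;> simp <;> ring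
    · ext i; fin_cases i <;> simp <;> field_simp <;> nlinarith
    · simp
      linear_combination h + (s ^ 2 + c ^ 2) / 4 * hk3 + (c - k * s) ^ 2 / 4 * hσ2
    · simp
      linear_combination hk3 / 4 + k ^ 2 / 4 * hσ2
    · have : σ * (c - k * s) / 2 * (-(σ * k) / 2) = (3 * s - k * c) / 4 := by
        linear_combination s / 4 * hk3 - k * (c - k * s) / 4 * hσ2
      simp
      linarith
  · refine two_pi_div_three_le_angle_straight (r := -1) (by norm_num) ?_ ?_
    · intro h0
      have := congrArg (fun v : Pt => v 1) h0
      simp at this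
      nlinarith
    · ext i; fin_cases i <;> simp <;> ring
  · refine ⟨[(!₂[0, -1, 0], -s), (!₂[σ, 0, 0], 0)], ?_, fun x hx => hP x ?_ ?_⟩
    · have : 0 ≤ c + k * s := by linarith
      rcases hσ with rfl | rfl <;> simp [inner_eq_sum] <;> constructorm* _ ∧ _ <;> nlinarith
    · simp [inner_eq_sum] at hx; linarith
    · simp [inner_eq_sum] at hx; linarith

/-- The vertices of the triangle gadget. -/
def triangleVertex (k c s : ℝ) : Fin 3 → Pt :=
  ![!₂[c, s, 0], !₂[-c, s, 0], !₂[0, -(2 * k * c / 3), 0]]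

/-- The bends of the triangle gadget. -/
def triangleBend (k c s : ℝ) : Fin 3 → Fin 3 → Pt :=
  ![![0, !₂[(3 * c - k * s) / 4, (3 * s + k * c) / 4, 0], !₂[(c + k * s) / 2, (s - k * c) / 2, 0]],
    ![!₂[-(3 * c - k * s) / 4, (3 * s + k * c) / 4, 0], 0,
      !₂[-(c + k * s) / 2, (s - k * c) / 2, 0]],
    ![!₂[(c + k * s) / 4, (s - k * c) / 4 - k * c / 3, 0],
      !₂[-(c + k * s) / 4, (s - k * c) / 4 - k * c / 3, 0], 0]]

/-- The edge of the triangle gadget to whose region a point belongs. -/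
def triangleRegion (s : ℝ) (x : Pt) : Option (Sym2 (Fin 3)) :=
  if s < x 1 then some s(0, 1) else if x 1 < s ∧ 0 < x 0 then some s(0, 2) else
    if x 1 < s ∧ x 0 < 0 then some s(1, 2) else none

theorem isGoodDrawing_triangle (hk : 0 < k) (hk3 : k ^ 2 = 3) (hc : k / 2 ≤ c)
    (hs0 : 0 ≤ s) (hs : s ≤ 1 / 2) (h : c ^ 2 + s ^ 2 = 1) :
    IsGoodDrawing ⊤ (triangleVertex k c s)
      (twoBendSeq (triangleVertex k c s) (triangleBend k c s)) (2 * Real.pi / 3) := by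
  have h1 : 1 ≤ c + k * s := by
    nlinarith [mul_nonneg hk.le hs0,
      mul_nonneg (by linarith : (0 : ℝ) ≤ c) (mul_nonneg hk.le hs0)]
  have h2 : 1 ≤ k * c - s := by nlinarith
  have hkc : 0 < k * c := by nlinarith
  refine isGoodDrawing_twoBendSeq ?_ (triangleRegion s) ?_ ?_ ?_
  · intro i j hij
    have := congrArg (fun v : Pt => v 0) hij
    fin_cases i <;> fin_cases j <;> simp [triangleVertex] at this ⊢ <;> linarith
  · intro i
    fin_cases i <;> simp [triangleVertex, triangleRegion]
    nlinarith
  · intro i j hij _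
    have : (i = 0 ∧ j = 1) ∨ (i = 0 ∧ j = 2) ∨ (i = 1 ∧ j = 2) := by
      revert i j; decide
    rcases this with ⟨rfl, rfl⟩ | ⟨rfl, rfl⟩ | ⟨rfl, rfl⟩
    · exact isGoodPath_triangle_top hk hk3 hc hs0 hs h fun x hx => by simp [triangleRegion, hx]
    · have := isGoodPath_triangle_side hk hk3 hc hs0 hs h (σ := 1) (.inl rfl)
        (P := fun x => triangleRegion s x = some s((0 : Fin 3), 2))
        fun x hx hx' => by
          rw [one_mul] at hx'
          simp [triangleRegion, hx, hx', hx.not_gt]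
      simpa [triangleVertex, triangleBend] using this
    · have := isGoodPath_triangle_side hk hk3 hc hs0 hs h (σ := -1) (.inr rfl)
        (P := fun x => triangleRegion s x = some s((1 : Fin 3), 2))
        fun x hx hx' => by
          have hx' : x 0 < 0 := by linarith
          simp [triangleRegion, hx, hx', hx.not_gt, hx'.not_gt]
      simpa [triangleVertex, triangleBend] using this
  · intro i j l hjl hij hil
    have : (i = 0 ∧ j = 1 ∧ l = 2) ∨ (i = 1 ∧ j = 0 ∧ l = 2) ∨ (i = 2 ∧ j = 0 ∧ l = 1) := by
      revert i j l; decide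
    rcases this with ⟨rfl, rfl, rfl⟩ | ⟨rfl, rfl, rfl⟩ | ⟨rfl, rfl, rfl⟩
    · refine two_pi_div_three_le_angle_of_coord (t := 1 / 2) (r := 1)
        !₂[-(c + k * s) / 2, (k * c - s) / 2, 0] !₂[(-c + k * s) / 2, (-s - k * c) / 2, 0]
        (by norm_num) (by norm_num) ?_ ?_ ?_ ?_ ?_
      · ext i; fin_cases i <;> simp [triangleVertex, triangleBend] <;> ring
      · ext i; fin_cases i <;> simp [triangleVertex, triangleBend] <;> ring
      · simp; nlinarith
      · simp; nlinarith
      · simp; nlinarith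
    · refine two_pi_div_three_le_angle_of_coord (t := 1 / 2) (r := 1)
        !₂[(c + k * s) / 2, (k * c - s) / 2, 0] !₂[-(-c + k * s) / 2, (-s - k * c) / 2, 0]
        (by norm_num) (by norm_num) ?_ ?_ ?_ ?_ ?_
      · ext i; fin_cases i <;> simp [triangleVertex, triangleBend] <;> ring
      · ext i; fin_cases i <;> simp [triangleVertex, triangleBend] <;> ring
      · simp; nlinarith
      · simp; nlinarith
      · simp; nlinarith
    · refine two_pi_div_three_le_angle_of_coord (t := (c + k * s) / (2 * k))
        (r := (c + k * s) / (2 * k)) !₂[k / 2, 1 / 2, 0] !₂[-k / 2, 1 / 2, 0]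
        (by positivity) (by positivity) ?_ ?_ ?_ ?_ ?_
      · ext i; fin_cases i <;> simp [triangleVertex, triangleBend] <;> field_simp <;> nlinarith
      · ext i; fin_cases i <;> simp [triangleVertex, triangleBend] <;> field_simp <;> nlinarith
      · simp; nlinarith
      · simp; nlinarith
      · simp; nlinarith

theorem isPort_triangle_zero (hk : 0 < k) (hk3 : k ^ 2 = 3) (hc : k / 2 ≤ c)
    (hs0 : 0 ≤ s) (hs : s ≤ 1 / 2) (h : c ^ 2 + s ^ 2 = 1) :
    IsPort ⊤ (triangleVertex k c s) (triangleBend k c s) (2 * Real.pi / 3) 0 !₂[c, s, 0] := by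
  have h1 : 1 ≤ c + k * s := by
    nlinarith [mul_nonneg hk.le hs0,
      mul_nonneg (by linarith : (0 : ℝ) ≤ c) (mul_nonneg hk.le hs0)]
  have h2 : 1 ≤ k * c - s := by nlinarith
  have hkc : 0 < k * c := by nlinarith
  refine ⟨?_, ?_, ?_, ?_⟩
  · exact ⟨1, by norm_num, by simp [triangleVertex]⟩
  · intro j hj
    fin_cases j <;> (rw [inner_eq_sum, inner_eq_sum]; simp [triangleVertex] at hj ⊢; try nlinarith)
  · intro j l hjl
    fin_cases j <;> fin_cases l <;>
      (rw [inner_eq_sum, inner_eq_sum]; simp [triangleVertex, triangleBend] at hjl ⊢; try nlinarith)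
  · intro j hj
    fin_cases j
    · exact absurd hj (SimpleGraph.irrefl _)
    · refine two_pi_div_three_le_angle_of_coord (t := 1 / 2) (r := 1)
        !₂[-(c + k * s) / 2, (k * c - s) / 2, 0] !₂[c, s, 0] (by norm_num) (by norm_num)
        ?_ (by simp) ?_ (by simpa using h) ?_
      · ext i; fin_cases i <;> simp [triangleVertex, triangleBend] <;> ring
      · simp; nlinarith
      · simp; nlinarith
    · refine two_pi_div_three_le_angle_of_coord (t := 1) (r := 1)
        !₂[(-c + k * s) / 2, (-s - k * c) / 2, 0] !₂[c, s, 0] (by norm_num) (by norm_num)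
        ?_ (by simp) ?_ (by simpa using h) ?_
      · ext i; fin_cases i <;> simp [triangleVertex, triangleBend] <;> ring
      · simp; nlinarith
      · simp; nlinarith

theorem isPort_triangle_one (hk : 0 < k) (hk3 : k ^ 2 = 3) (hc : k / 2 ≤ c)
    (hs0 : 0 ≤ s) (hs : s ≤ 1 / 2) (h : c ^ 2 + s ^ 2 = 1) :
    IsPort ⊤ (triangleVertex k c s) (triangleBend k c s) (2 * Real.pi / 3) 1 !₂[-c, s, 0] := by
  have h1 : 1 ≤ c + k * s := by
    nlinarith [mul_nonneg hk.le hs0,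
      mul_nonneg (by linarith : (0 : ℝ) ≤ c) (mul_nonneg hk.le hs0)]
  have h2 : 1 ≤ k * c - s := by nlinarith
  have hkc : 0 < k * c := by nlinarith
  refine ⟨?_, ?_, ?_, ?_⟩
  · exact ⟨1, by norm_num, by simp [triangleVertex]⟩
  · intro j hj
    fin_cases j <;> (rw [inner_eq_sum, inner_eq_sum]; simp [triangleVertex] at hj ⊢; try nlinarith)
  · intro j l hjl
    fin_cases j <;> fin_cases l <;>
      (rw [inner_eq_sum, inner_eq_sum]; simp [triangleVertex, triangleBend] at hjl ⊢; try nlinarith)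
  · intro j hj
    fin_cases j
    · refine two_pi_div_three_le_angle_of_coord (t := 1 / 2) (r := 1)
        !₂[(c + k * s) / 2, (k * c - s) / 2, 0] !₂[-c, s, 0] (by norm_num) (by norm_num)
        ?_ (by simp) ?_ (by simpa using h) ?_
      · ext i; fin_cases i <;> simp [triangleVertex, triangleBend] <;> ring
      · simp; nlinarith
      · simp; nlinarith
    · exact absurd hj (SimpleGraph.irrefl _)
    · refine two_pi_div_three_le_angle_of_coord (t := 1) (r := 1)
        !₂[-(-c + k * s) / 2, (-s - k * c) / 2, 0] !₂[-c, s, 0] (by norm_num) (by norm_num)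
        ?_ (by simp) ?_ (by simpa using h) ?_
      · ext i; fin_cases i <;> simp [triangleVertex, triangleBend] <;> ring
      · simp; nlinarith
      · simp; nlinarith

theorem isPort_triangle_two (hk : 0 < k) (hk3 : k ^ 2 = 3) (hc : k / 2 ≤ c)
    (hs0 : 0 ≤ s) (hs : s ≤ 1 / 2) (h : c ^ 2 + s ^ 2 = 1) :
    IsPort ⊤ (triangleVertex k c s) (triangleBend k c s) (2 * Real.pi / 3) 2 !₂[0, -1, 0] := by
  have h1 : 1 ≤ c + k * s := by
    nlinarith [mul_nonneg hk.le hs0,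
      mul_nonneg (by linarith : (0 : ℝ) ≤ c) (mul_nonneg hk.le hs0)]
  have h2 : 1 ≤ k * c - s := by nlinarith
  have hkc : 0 < k * c := by nlinarith
  refine ⟨?_, ?_, ?_, ?_⟩
  · exact ⟨2 * k * c / 3, by linarith, by ext i; fin_cases i <;> simp [triangleVertex]⟩
  · intro j hj
    fin_cases j <;> (rw [inner_eq_sum, inner_eq_sum]; simp [triangleVertex] at hj ⊢; try nlinarith)
  · intro j l hjl
    fin_cases j <;> fin_cases l <;>
      (rw [inner_eq_sum, inner_eq_sum]; simp [triangleVertex, triangleBend] at hjl ⊢; try nlinarith)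
  · intro j hj
    fin_cases j
    · refine two_pi_div_three_le_angle_of_coord (t := (c + k * s) / (2 * k)) (r := 1)
        !₂[k / 2, 1 / 2, 0] !₂[0, -1, 0] (by positivity) (by norm_num) ?_ (by simp) ?_ (by simp) ?_
      · ext i; fin_cases i <;> simp [triangleVertex, triangleBend] <;> field_simp <;> nlinarith
      · simp; nlinarith
      · simp; nlinarith
    · refine two_pi_div_three_le_angle_of_coord (t := (c + k * s) / (2 * k)) (r := 1)
        !₂[-k / 2, 1 / 2, 0] !₂[0, -1, 0] (by positivity) (by norm_num) ?_ (by simp) ?_ (by simp) ?_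
      · ext i; fin_cases i <;> simp [triangleVertex, triangleBend] <;> field_simp <;> nlinarith
      · simp; nlinarith
      · simp; nlinarith
    · exact absurd hj (SimpleGraph.irrefl _)

theorem exists_triangle_gadget (hc : 0 < c) (hs0 : 0 ≤ s) (hs : s ≤ 1 / 2)
    (h : c ^ 2 + s ^ 2 = 1) : ∃ (g : Fin 3 → Pt) (n : Fin 3 → Fin 3 → Pt),
      IsGoodDrawing ⊤ g (twoBendSeq g n) (2 * Real.pi / 3) ∧
      IsPort ⊤ g n (2 * Real.pi / 3) 0 !₂[c, s, 0] ∧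
      IsPort ⊤ g n (2 * Real.pi / 3) 1 !₂[-c, s, 0] ∧
      IsPort ⊤ g n (2 * Real.pi / 3) 2 !₂[0, -1, 0] := by
  obtain ⟨k, hk, hk3⟩ : ∃ k : ℝ, 0 < k ∧ k ^ 2 = 3 := ⟨√3, by positivity, by norm_num⟩
  have hck : k / 2 ≤ c := by nlinarith
  exact ⟨_, _, isGoodDrawing_triangle hk hk3 hck hs0 hs h,
    isPort_triangle_zero hk hk3 hck hs0 hs h, isPort_triangle_one hk hk3 hck hs0 hs h,
    isPort_triangle_two hk hk3 hck hs0 hs h⟩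

/-! ### The diamond gadget -/

theorem isGoodPath_diamond_side (hk : 0 < k) (hk3 : k ^ 2 = 3) (hc : k / 2 ≤ c)
    (h : c ^ 2 + s ^ 2 = 1) {σ τ : ℝ} (hσ : σ = 1 ∨ σ = -1) (hτ : τ = 1 ∨ τ = -1) {P : Pt → Prop}
    (hP : ∀ x : Pt, 0 < σ * x 0 → 0 < τ * x 2 → k * c < k * (σ * x 0) + 2 * c * (τ * x 2) → P x) :
    IsGoodPath !₂[σ * c, s, 0] !₂[σ * c / 2, s / 2, τ * k / 2]
      !₂[σ * c / 4, s / 2, τ * (k / 2 + k * c / 12)] !₂[0, s / 2, τ * k / 2]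
      (2 * Real.pi / 3) P := by
  have hc0 : 0 < c := by linarith
  have hkc : 0 < k * c := by positivity
  have hkcc : 0 < k * c * c := by positivity
  have hσ2 : σ ^ 2 = 1 := by rcases hσ with rfl | rfl <;> norm_num
  have hτ2 : τ ^ 2 = 1 := by rcases hτ with rfl | rfl <;> norm_num
  constructor
  · refine ⟨innerₛₗ ℝ !₂[-σ, 0, 0], ?_, ?_, ?_⟩ <;> simp [inner_eq_sum] <;> nlinarith
  · refine two_pi_div_three_le_angle_of_coord (t := 1) (r := c / (2 * k))
      !₂[σ * c / 2, s / 2, -τ * k / 2] !₂[-σ * k / 2, 0, τ / 2] (by norm_num)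
      (by positivity) ?_ ?_ ?_ ?_ ?_
    · ext i; fin_cases i <;> simp <;> ring
    · ext i; fin_cases i <;> simp <;> field_simp <;> (try rw [hk3]) <;> ring
    · simp
      linear_combination h / 4 + hk3 / 4 + c ^ 2 / 4 * hσ2 + k ^ 2 / 4 * hτ2
    · simp
      linear_combination hk3 / 4 + k ^ 2 / 4 * hσ2 + hτ2 / 4
    · have : σ * c / 2 * (-(σ * k) / 2) + -(τ * k) / 2 * (τ / 2) = - k * (c + 1) / 4 := by
        linear_combination - c * k / 4 * hσ2 - k / 4 * hτ2
      simp
      nlinarith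
  · refine two_pi_div_three_le_angle_of_coord (t := c / (2 * k)) (r := c / (2 * k))
      !₂[-σ * k / 2, 0, -τ / 2] !₂[σ * k / 2, 0, -τ / 2] (by positivity)
      (by positivity) ?_ ?_ ?_ ?_ ?_
    · ext i; fin_cases i <;> simp <;> field_simp <;> (try rw [hk3]) <;> ring
    · ext i; fin_cases i <;> simp <;> field_simp <;> (try rw [hk3]) <;> ring
    · simp
      linear_combination hk3 / 4 + k ^ 2 / 4 * hσ2 + hτ2 / 4
    · simp
      linear_combination hk3 / 4 + k ^ 2 / 4 * hσ2 + hτ2 / 4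
    · have : -(σ * k) / 2 * (σ * k / 2) + -τ / 2 * (-τ / 2) = -1 / 2 := by
        linear_combination - k ^ 2 / 4 * hσ2 + hτ2 / 4 - hk3 / 4
      simp
      linarith
  · refine ⟨[(!₂[σ, 0, 0], 0), (!₂[0, 0, τ], 0), (!₂[k * σ, 0, 2 * c * τ], k * c)], ?_,
      fun x hx => hP x ?_ ?_ ?_⟩
    · rcases hσ with rfl | rfl <;> rcases hτ with rfl | rfl <;> simp [inner_eq_sum] <;>
        constructorm* _ ∧ _ <;> nlinarith
    · simp [inner_eq_sum] at hx; linarith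
    · simp [inner_eq_sum] at hx; linarith
    · simp [inner_eq_sum] at hx; linarith

theorem isGoodPath_diamond_middle (hk : 0 < k) (hc : 0 < c) {P : Pt → Prop}
    (hP : ∀ x : Pt, k * |x 0| + 2 * c * |x 2| < k * c → P x) :
    IsGoodPath !₂[0, s / 2, k / 2] !₂[0, s / 2, k / 6] !₂[0, s / 2, -k / 6] !₂[0, s / 2, -k / 2]
      (2 * Real.pi / 3) P := by
  have hkc : 0 < k * c := by positivity
  constructor
  · refine ⟨innerₛₗ ℝ !₂[0, 0, -1], ?_, ?_, ?_⟩ <;> simp [inner_eq_sum] <;> nlinarith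
  · refine two_pi_div_three_le_angle_straight (r := -1) (by norm_num) ?_ ?_
    · intro h0
      have := congrArg (fun v : Pt => v 2) h0
      simp at this
      linarith
    · ext i; fin_cases i <;> simp; ring
  · refine two_pi_div_three_le_angle_straight (r := -1) (by norm_num) ?_ ?_
    · intro h0
      have := congrArg (fun v : Pt => v 2) h0
      simp at this
      linarith
    · ext i; fin_cases i <;> simp; ring
  · refine ⟨[(!₂[k, 0, 2 * c], -(k * c)), (!₂[k, 0, -2 * c], -(k * c)),
      (!₂[-k, 0, 2 * c], -(k * c)), (!₂[-k, 0, -2 * c], -(k * c))], ?_, fun x hx => hP x ?_⟩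
    · simp [inner_eq_sum]
      constructorm* _ ∧ _ <;> nlinarith
    · simp [inner_eq_sum] at hx
      obtain ⟨h1, h2, h3, h4⟩ := hx
      cases abs_cases (x 0) <;> cases abs_cases (x 2) <;> nlinarith

/-- The complete graph on four vertices with one edge removed. -/
def diamondGraph : SimpleGraph (Fin 4) :=
  (⊤ : SimpleGraph (Fin 4)).deleteEdges {s(0, 1)}

theorem diamondGraph_adj {i j : Fin 4} : diamondGraph.Adj i j ↔ i ≠ j ∧ s(i, j) ≠ s(0, 1) := by
  simp [diamondGraph]

/-- The vertices of the diamond gadget. -/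
def diamondVertex (k c s : ℝ) : Fin 4 → Pt :=
  ![!₂[c, s, 0], !₂[-c, s, 0], !₂[0, s / 2, k / 2], !₂[0, s / 2, -k / 2]]

/-- The bends of the diamond gadget. -/
def diamondBend (k c s : ℝ) : Fin 4 → Fin 4 → Pt :=
  ![![0, 0, !₂[c / 2, s / 2, k / 2], !₂[c / 2, s / 2, -k / 2]],
    ![0, 0, !₂[-c / 2, s / 2, k / 2], !₂[-c / 2, s / 2, -k / 2]],
    ![!₂[c / 4, s / 2, k / 2 + k * c / 12], !₂[-c / 4, s / 2, k / 2 + k * c / 12], 0,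
      !₂[0, s / 2, k / 6]],
    ![!₂[c / 4, s / 2, -(k / 2 + k * c / 12)], !₂[-c / 4, s / 2, -(k / 2 + k * c / 12)],
      !₂[0, s / 2, -k / 6], 0]]

/-- The edge of the diamond gadget to whose region a point belongs. -/
def diamondRegion (k c : ℝ) (x : Pt) : Option (Sym2 (Fin 4)) :=
  if k * |x 0| + 2 * c * |x 2| < k * c then some s(2, 3)
  else if k * |x 0| + 2 * c * |x 2| = k * c then none
  else if 0 < x 0 ∧ 0 < x 2 then some s(0, 2) else if 0 < x 0 ∧ x 2 < 0 then some s(0, 3)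
  else if x 0 < 0 ∧ 0 < x 2 then some s(1, 2) else if x 0 < 0 ∧ x 2 < 0 then some s(1, 3)
  else none

theorem isGoodDrawing_diamond (hk : 0 < k) (hk3 : k ^ 2 = 3) (hc : k / 2 ≤ c)
    (h : c ^ 2 + s ^ 2 = 1) : IsGoodDrawing diamondGraph (diamondVertex k c s)
      (twoBendSeq (diamondVertex k c s) (diamondBend k c s)) (2 * Real.pi / 3) := by
  have hc0 : 0 < c := by linarith
  have hkc : 0 < k * c := by positivity
  refine isGoodDrawing_twoBendSeq ?_ (diamondRegion k c) ?_ ?_ ?_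
  · intro i j hij
    have h0 := congrArg (fun v : Pt => v 0) hij
    have h2 := congrArg (fun v : Pt => v 2) hij
    fin_cases i <;> fin_cases j <;> simp [diamondVertex] at h0 h2 ⊢ <;> linarith
  · intro i
    fin_cases i <;> simp [diamondVertex, diamondRegion, abs_of_pos hc0, abs_of_pos hk, abs_div] <;>
      ring_nf <;> simp
  · intro i j hij hadj
    rw [diamondGraph_adj] at hadj
    have : (i = 0 ∧ j = 2) ∨ (i = 0 ∧ j = 3) ∨ (i = 1 ∧ j = 2) ∨ (i = 1 ∧ j = 3) ∨
        (i = 2 ∧ j = 3) := by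
      revert i j; decide
    rcases this with ⟨rfl, rfl⟩ | ⟨rfl, rfl⟩ | ⟨rfl, rfl⟩ | ⟨rfl, rfl⟩ | ⟨rfl, rfl⟩
    · have := isGoodPath_diamond_side hk hk3 hc h (σ := 1) (τ := 1) (.inl rfl) (.inl rfl)
        (P := fun x => diamondRegion k c x = some s(0, 2)) fun x hx hz hxz => by
          rw [one_mul] at hx hz
          rw [one_mul, one_mul] at hxz
          simp [diamondRegion, abs_of_pos hx, abs_of_pos hz, hxz.not_gt, hxz.ne', hx, hz]
      simpa [diamondVertex, diamondBend] using this
    · have := isGoodPath_diamond_side hk hk3 hc h (σ := 1) (τ := -1) (.inl rfl) (.inr rfl)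
        (P := fun x => diamondRegion k c x = some s(0, 3)) fun x hx hz hxz => by
          rw [one_mul] at hx
          rw [neg_one_mul] at hz
          rw [one_mul, neg_one_mul] at hxz
          have hz := neg_pos.1 hz
          simp [diamondRegion, abs_of_pos hx, abs_of_neg hz, hxz.not_gt, hxz.ne', hx, hz, hz.not_gt,
            -mul_neg]
      simpa [diamondVertex, diamondBend] using this
    · have := isGoodPath_diamond_side hk hk3 hc h (σ := -1) (τ := 1) (.inr rfl) (.inl rfl)
        (P := fun x => diamondRegion k c x = some s(1, 2)) fun x hx hz hxz => by
          rw [one_mul] at hz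
          rw [neg_one_mul] at hx
          rw [one_mul, neg_one_mul] at hxz
          have hx := neg_pos.1 hx
          simp [diamondRegion, abs_of_neg hx, abs_of_pos hz, hxz.not_gt, hxz.ne', hx, hz, hx.not_gt,
            -mul_neg]
      simpa [diamondVertex, diamondBend] using this
    · have := isGoodPath_diamond_side hk hk3 hc h (σ := -1) (τ := -1) (.inr rfl) (.inr rfl)
        (P := fun x => diamondRegion k c x = some s(1, 3)) fun x hx hz hxz => by
          rw [neg_one_mul] at hx hz
          rw [neg_one_mul, neg_one_mul] at hxz
          have hx := neg_pos.1 hx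
          have hz := neg_pos.1 hz
          simp [diamondRegion, abs_of_neg hx, abs_of_neg hz, hxz.not_gt, hxz.ne', hx, hz, hx.not_gt,
            hz.not_gt, -mul_neg]
      simpa [diamondVertex, diamondBend] using this
    · exact isGoodPath_diamond_middle hk hc0 fun x hx => by simp [diamondRegion, hx]
  · intro i j l hjl hij hil
    rw [diamondGraph_adj] at hij hil
    have hd : ∀ {a b : Pt} {t r : ℝ} (d e : Pt), 0 < t → 0 < r → a = t • d → b = r • e →
        d 0 ^ 2 + d 1 ^ 2 + d 2 ^ 2 = 1 → e 0 ^ 2 + e 1 ^ 2 + e 2 ^ 2 = 1 →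
        d 0 * e 0 + d 1 * e 1 + d 2 * e 2 ≤ -1 / 2 → 2 * Real.pi / 3 ≤ angle a b :=
      two_pi_div_three_le_angle_of_coord
    have hck : 0 < c / (2 * k) := by positivity
    have : (i = 0 ∧ j = 2 ∧ l = 3) ∨ (i = 1 ∧ j = 2 ∧ l = 3) ∨ (i = 2 ∧ j = 0 ∧ l = 1) ∨
        (i = 2 ∧ j = 0 ∧ l = 3) ∨ (i = 2 ∧ j = 1 ∧ l = 3) ∨ (i = 3 ∧ j = 0 ∧ l = 1) ∨
        (i = 3 ∧ j = 0 ∧ l = 2) ∨ (i = 3 ∧ j = 1 ∧ l = 2) := by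
      revert i j l; decide
    rcases this with ⟨rfl, rfl, rfl⟩ | ⟨rfl, rfl, rfl⟩ | ⟨rfl, rfl, rfl⟩ | ⟨rfl, rfl, rfl⟩ |
      ⟨rfl, rfl, rfl⟩ | ⟨rfl, rfl, rfl⟩ | ⟨rfl, rfl, rfl⟩ | ⟨rfl, rfl, rfl⟩
    · refine hd !₂[-c / 2, -s / 2, k / 2] !₂[-c / 2, -s / 2, -k / 2] one_pos one_pos ?_ ?_ ?_ ?_ ?_
      · ext i; fin_cases i <;> simp [diamondVertex, diamondBend] <;> ring
      · ext i; fin_cases i <;> simp [diamondVertex, diamondBend] <;> ring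
      all_goals simp; nlinarith
    · refine hd !₂[c / 2, -s / 2, k / 2] !₂[c / 2, -s / 2, -k / 2] one_pos one_pos ?_ ?_ ?_ ?_ ?_
      · ext i; fin_cases i <;> simp [diamondVertex, diamondBend] <;> ring
      · ext i; fin_cases i <;> simp [diamondVertex, diamondBend] <;> ring
      all_goals simp; nlinarith
    · refine hd !₂[k / 2, 0, 1 / 2] !₂[-k / 2, 0, 1 / 2] hck hck ?_ ?_ ?_ ?_ ?_
      · ext i; fin_cases i <;> simp [diamondVertex, diamondBend] <;> field_simp <;> nlinarith
      · ext i; fin_cases i <;> simp [diamondVertex, diamondBend] <;> field_simp <;> nlinarith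
      all_goals simp; nlinarith
    · refine hd (r := k / 3) !₂[k / 2, 0, 1 / 2] !₂[0, 0, -1] hck (by positivity) ?_ ?_ ?_ ?_ ?_
      · ext i; fin_cases i <;> simp [diamondVertex, diamondBend] <;> field_simp <;> nlinarith
      · ext i; fin_cases i <;> simp [diamondVertex, diamondBend]; ring
      all_goals simp; try nlinarith
    · refine hd (r := k / 3) !₂[-k / 2, 0, 1 / 2] !₂[0, 0, -1] hck (by positivity) ?_ ?_ ?_ ?_ ?_
      · ext i; fin_cases i <;> simp [diamondVertex, diamondBend] <;> field_simp <;> nlinarith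
      · ext i; fin_cases i <;> simp [diamondVertex, diamondBend]; ring
      all_goals simp; try nlinarith
    · refine hd !₂[k / 2, 0, -1 / 2] !₂[-k / 2, 0, -1 / 2] hck hck ?_ ?_ ?_ ?_ ?_
      · ext i; fin_cases i <;> simp [diamondVertex, diamondBend] <;> field_simp <;> nlinarith
      · ext i; fin_cases i <;> simp [diamondVertex, diamondBend] <;> field_simp <;> nlinarith
      all_goals simp; nlinarith
    · refine hd (r := k / 3) !₂[k / 2, 0, -1 / 2] !₂[0, 0, 1] hck (by positivity) ?_ ?_ ?_ ?_ ?_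
      · ext i; fin_cases i <;> simp [diamondVertex, diamondBend] <;> field_simp <;> nlinarith
      · ext i; fin_cases i <;> simp [diamondVertex, diamondBend]; ring
      all_goals simp; try nlinarith
    · refine hd (r := k / 3) !₂[-k / 2, 0, -1 / 2] !₂[0, 0, 1] hck (by positivity) ?_ ?_ ?_ ?_ ?_
      · ext i; fin_cases i <;> simp [diamondVertex, diamondBend] <;> field_simp <;> nlinarith
      · ext i; fin_cases i <;> simp [diamondVertex, diamondBend]; ring
      all_goals simp; try nlinarith

theorem isPort_diamond_zero (hk3 : k ^ 2 = 3) (hc : 0 < c) (h : c ^ 2 + s ^ 2 = 1) :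
    IsPort diamondGraph (diamondVertex k c s) (diamondBend k c s) (2 * Real.pi / 3) 0
      !₂[c, s, 0] := by
  have hc2 : 0 < c ^ 2 := by positivity
  refine ⟨?_, ?_, ?_, ?_⟩
  · exact ⟨1, by norm_num, by simp [diamondVertex]⟩
  · intro j hj
    fin_cases j <;> (rw [inner_eq_sum, inner_eq_sum]; simp [diamondVertex] at hj ⊢; try nlinarith)
  · intro j l hjl
    fin_cases j <;> fin_cases l <;> (rw [inner_eq_sum, inner_eq_sum]
                                     simp [diamondVertex, diamondBend]
                                     nlinarith)
  · intro j hj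
    rw [diamondGraph_adj] at hj
    fin_cases j
    · exact absurd rfl hj.1
    · exact absurd rfl hj.2
    · refine two_pi_div_three_le_angle_of_coord (t := 1) (r := 1)
        !₂[-c / 2, -s / 2, k / 2] !₂[c, s, 0] one_pos one_pos ?_ (by simp) ?_ (by simpa using h) ?_
      · ext i; fin_cases i <;> simp [diamondVertex, diamondBend] <;> ring
      all_goals simp; nlinarith
    · refine two_pi_div_three_le_angle_of_coord (t := 1) (r := 1)
        !₂[-c / 2, -s / 2, -k / 2] !₂[c, s, 0] one_pos one_pos ?_ (by simp) ?_ (by simpa using h) ?_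
      · ext i; fin_cases i <;> simp [diamondVertex, diamondBend] <;> ring
      all_goals simp; nlinarith

theorem isPort_diamond_one (hk3 : k ^ 2 = 3) (hc : 0 < c) (h : c ^ 2 + s ^ 2 = 1) :
    IsPort diamondGraph (diamondVertex k c s) (diamondBend k c s) (2 * Real.pi / 3) 1
      !₂[-c, s, 0] := by
  have hc2 : 0 < c ^ 2 := by positivity
  refine ⟨?_, ?_, ?_, ?_⟩
  · exact ⟨1, by norm_num, by simp [diamondVertex]⟩
  · intro j hj
    fin_cases j <;> (rw [inner_eq_sum, inner_eq_sum]; simp [diamondVertex] at hj ⊢; try nlinarith)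
  · intro j l hjl
    fin_cases j <;> fin_cases l <;> (rw [inner_eq_sum, inner_eq_sum]
                                     simp [diamondVertex, diamondBend]
                                     nlinarith)
  · intro j hj
    rw [diamondGraph_adj] at hj
    fin_cases j
    · exact absurd (Sym2.eq_swap) hj.2
    · exact absurd rfl hj.1
    · refine two_pi_div_three_le_angle_of_coord (t := 1) (r := 1)
        !₂[c / 2, -s / 2, k / 2] !₂[-c, s, 0] one_pos one_pos ?_ (by simp) ?_ (by simpa using h) ?_
      · ext i; fin_cases i <;> simp [diamondVertex, diamondBend] <;> ring
      all_goals simp; nlinarith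
    · refine two_pi_div_three_le_angle_of_coord (t := 1) (r := 1)
        !₂[c / 2, -s / 2, -k / 2] !₂[-c, s, 0] one_pos one_pos ?_ (by simp) ?_ (by simpa using h) ?_
      · ext i; fin_cases i <;> simp [diamondVertex, diamondBend] <;> ring
      all_goals simp; nlinarith

theorem exists_diamond_gadget (hc : 0 < c) (hs0 : 0 ≤ s) (hs : s ≤ 1 / 2)
    (h : c ^ 2 + s ^ 2 = 1) : ∃ (g : Fin 4 → Pt) (n : Fin 4 → Fin 4 → Pt),
      IsGoodDrawing diamondGraph g (twoBendSeq g n) (2 * Real.pi / 3) ∧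
      IsPort diamondGraph g n (2 * Real.pi / 3) 0 !₂[c, s, 0] ∧
      IsPort diamondGraph g n (2 * Real.pi / 3) 1 !₂[-c, s, 0] := by
  obtain ⟨k, hk, hk3⟩ : ∃ k : ℝ, 0 < k ∧ k ^ 2 = 3 := ⟨√3, by positivity, by norm_num⟩
  have hck : k / 2 ≤ c := by nlinarith
  exact ⟨_, _, isGoodDrawing_diamond hk hk3 hck h, isPort_diamond_zero hk3 hc h,
    isPort_diamond_one hk3 hc h⟩

end

/-! ### The gadgets for complete graphs on four vertices -/

theorem two_pi_div_three_le_angle_of_sq {a b : Pt} (h : a 0 * b 0 + a 1 * b 1 + a 2 * b 2 < 0)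
    (h' : (a 0 ^ 2 + a 1 ^ 2 + a 2 ^ 2) * (b 0 ^ 2 + b 1 ^ 2 + b 2 ^ 2) ≤
      4 * (a 0 * b 0 + a 1 * b 1 + a 2 * b 2) ^ 2) : 2 * Real.pi / 3 ≤ angle a b := by
  rw [← inner_eq_sum] at h h'
  refine two_pi_div_three_le_angle h ?_
  simpa only [EuclideanSpace.norm_sq_eq, Fin.sum_univ_three, Real.norm_eq_abs, sq_abs] using h'

theorem isGoodPath_cube_fst {σ : ℝ} (hσ : σ = 1 ∨ σ = -1) {P : Pt → Prop}
    (hP : ∀ x : Pt, 1 < σ * x 0 → |x 1| < 1 → |x 2| < 1 → P x) :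
    IsGoodPath !₂[σ, 1, σ] !₂[2 * σ, 1 / 2, σ / 2] !₂[2 * σ, -1 / 2, -σ / 2] !₂[σ, -1, -σ]
      (2 * Real.pi / 3) P := by
  constructor
  · refine ⟨innerₛₗ ℝ !₂[0, -1, 0], ?_, ?_, ?_⟩ <;> simp [inner_eq_sum] <;> norm_num
  · refine two_pi_div_three_le_angle_of_sq ?_ ?_ <;> rcases hσ with rfl | rfl <;> simp <;> norm_num
  · refine two_pi_div_three_le_angle_of_sq ?_ ?_ <;> rcases hσ with rfl | rfl <;> simp <;> norm_num
  · refine ⟨[(!₂[σ, 0, 0], 1), (!₂[0, 1, 0], -1), (!₂[0, -1, 0], -1), (!₂[0, 0, 1], -1),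
      (!₂[0, 0, -1], -1)], ?_, fun x hx => ?_⟩
    · rcases hσ with rfl | rfl <;> simp [inner_eq_sum] <;> norm_num
    · simp [inner_eq_sum] at hx
      exact hP x (by linarith) (abs_lt.2 ⟨by linarith, by linarith⟩)
        (abs_lt.2 ⟨by linarith, by linarith⟩)

theorem isGoodPath_cube_snd {σ : ℝ} (hσ : σ = 1 ∨ σ = -1) {P : Pt → Prop}
    (hP : ∀ x : Pt, 1 < σ * x 1 → |x 0| < 1 → |x 2| < 1 → P x) :
    IsGoodPath !₂[1, σ, σ] !₂[1 / 2, 2 * σ, σ / 2] !₂[-1 / 2, 2 * σ, -σ / 2] !₂[-1, σ, -σ]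
      (2 * Real.pi / 3) P := by
  constructor
  · refine ⟨innerₛₗ ℝ !₂[-1, 0, 0], ?_, ?_, ?_⟩ <;> simp [inner_eq_sum] <;> norm_num
  · refine two_pi_div_three_le_angle_of_sq ?_ ?_ <;> rcases hσ with rfl | rfl <;> simp <;> norm_num
  · refine two_pi_div_three_le_angle_of_sq ?_ ?_ <;> rcases hσ with rfl | rfl <;> simp <;> norm_num
  · refine ⟨[(!₂[0, σ, 0], 1), (!₂[1, 0, 0], -1), (!₂[-1, 0, 0], -1), (!₂[0, 0, 1], -1),
      (!₂[0, 0, -1], -1)], ?_, fun x hx => ?_⟩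
    · rcases hσ with rfl | rfl <;> simp [inner_eq_sum] <;> norm_num
    · simp [inner_eq_sum] at hx
      exact hP x (by linarith) (abs_lt.2 ⟨by linarith, by linarith⟩)
        (abs_lt.2 ⟨by linarith, by linarith⟩)

theorem isGoodPath_cube_trd {σ : ℝ} (hσ : σ = 1 ∨ σ = -1) {P : Pt → Prop}
    (hP : ∀ x : Pt, 1 < σ * x 2 → |x 0| < 1 → |x 1| < 1 → P x) :
    IsGoodPath !₂[1, σ, σ] !₂[1 / 2, σ / 2, 2 * σ] !₂[-1 / 2, -σ / 2, 2 * σ] !₂[-1, -σ, σ]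
      (2 * Real.pi / 3) P := by
  constructor
  · refine ⟨innerₛₗ ℝ !₂[-1, 0, 0], ?_, ?_, ?_⟩ <;> simp [inner_eq_sum] <;> norm_num
  · refine two_pi_div_three_le_angle_of_sq ?_ ?_ <;> rcases hσ with rfl | rfl <;> simp <;> norm_num
  · refine two_pi_div_three_le_angle_of_sq ?_ ?_ <;> rcases hσ with rfl | rfl <;> simp <;> norm_num
  · refine ⟨[(!₂[0, 0, σ], 1), (!₂[1, 0, 0], -1), (!₂[-1, 0, 0], -1), (!₂[0, 1, 0], -1),
      (!₂[0, -1, 0], -1)], ?_, fun x hx => ?_⟩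
    · rcases hσ with rfl | rfl <;> simp [inner_eq_sum] <;> norm_num
    · simp [inner_eq_sum] at hx
      exact hP x (by linarith) (abs_lt.2 ⟨by linarith, by linarith⟩)
        (abs_lt.2 ⟨by linarith, by linarith⟩)

/-- The vertices of a regular tetrahedron. -/
def tetraVertex : Fin 4 → Pt :=
  ![!₂[1, 1, 1], !₂[1, -1, -1], !₂[-1, 1, -1], !₂[-1, -1, 1]]

/-- The bends of a drawing of the complete graph whose vertices are those of a regular
tetrahedron. -/
def tetraBend : Fin 4 → Fin 4 → Pt :=
  ![![0, !₂[2, 1 / 2, 1 / 2], !₂[1 / 2, 2, 1 / 2], !₂[1 / 2, 1 / 2, 2]],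
    ![!₂[2, -1 / 2, -1 / 2], 0, !₂[1 / 2, -1 / 2, -2], !₂[1 / 2, -2, -1 / 2]],
    ![!₂[-1 / 2, 2, -1 / 2], !₂[-1 / 2, 1 / 2, -2], 0, !₂[-2, 1 / 2, -1 / 2]],
    ![!₂[-1 / 2, -1 / 2, 2], !₂[-1 / 2, -2, 1 / 2], !₂[-2, -1 / 2, 1 / 2], 0]]

/-- The edge of the tetrahedron to whose region a point belongs. -/
def tetraRegion (x : Pt) : Option (Sym2 (Fin 4)) :=
  if 1 < x 0 ∧ |x 1| < 1 ∧ |x 2| < 1 then some s(0, 1)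
  else if x 0 < -1 ∧ |x 1| < 1 ∧ |x 2| < 1 then some s(2, 3)
  else if 1 < x 1 ∧ |x 0| < 1 ∧ |x 2| < 1 then some s(0, 2)
  else if x 1 < -1 ∧ |x 0| < 1 ∧ |x 2| < 1 then some s(1, 3)
  else if 1 < x 2 ∧ |x 0| < 1 ∧ |x 1| < 1 then some s(0, 3)
  else if x 2 < -1 ∧ |x 0| < 1 ∧ |x 1| < 1 then some s(1, 2) else none

theorem tetraVertex_injective : Function.Injective tetraVertex := by
  intro i j hij
  have h0 := congrArg (fun v : Pt => v 0) hij
  have h1 := congrArg (fun v : Pt => v 1) hij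
  fin_cases i <;> fin_cases j <;> simp [tetraVertex] at h0 h1 ⊢ <;> linarith

theorem tetraRegion_of_lt {x : Pt} :
    (1 < 1 * x 0 → |x 1| < 1 → |x 2| < 1 → tetraRegion x = some s(0, 1)) ∧
    (1 < -1 * x 0 → |x 1| < 1 → |x 2| < 1 → tetraRegion x = some s(2, 3)) ∧
    (1 < 1 * x 1 → |x 0| < 1 → |x 2| < 1 → tetraRegion x = some s(0, 2)) ∧
    (1 < -1 * x 1 → |x 0| < 1 → |x 2| < 1 → tetraRegion x = some s(1, 3)) ∧
    (1 < 1 * x 2 → |x 0| < 1 → |x 1| < 1 → tetraRegion x = some s(0, 3)) ∧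
    (1 < -1 * x 2 → |x 0| < 1 → |x 1| < 1 → tetraRegion x = some s(1, 2)) := by
  simp only [one_mul, neg_one_mul, abs_lt, tetraRegion]
  refine ⟨?_, ?_, ?_, ?_, ?_, ?_⟩ <;> rintro h ⟨h1, h2⟩ ⟨h3, h4⟩ <;> split_ifs <;> first
    | rfl
    | (exfalso; grind)

theorem isGoodPath_tetra {i j : Fin 4} (hij : i < j) :
    IsGoodPath (tetraVertex i) (tetraBend i j) (tetraBend j i) (tetraVertex j) (2 * Real.pi / 3)
      fun x => tetraRegion x = some s(i, j) := by
  have : (i = 0 ∧ j = 1) ∨ (i = 2 ∧ j = 3) ∨ (i = 0 ∧ j = 2) ∨ (i = 1 ∧ j = 3) ∨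
      (i = 0 ∧ j = 3) ∨ (i = 1 ∧ j = 2) := by
    revert i j; decide
  rcases this with ⟨rfl, rfl⟩ | ⟨rfl, rfl⟩ | ⟨rfl, rfl⟩ | ⟨rfl, rfl⟩ | ⟨rfl, rfl⟩ | ⟨rfl, rfl⟩
  · simpa [tetraVertex, tetraBend] using
      isGoodPath_cube_fst (.inl rfl) fun x => (tetraRegion_of_lt (x := x)).1
  · simpa [tetraVertex, tetraBend] using
      isGoodPath_cube_fst (.inr rfl) fun x => (tetraRegion_of_lt (x := x)).2.1
  · simpa [tetraVertex, tetraBend] using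
      isGoodPath_cube_snd (.inl rfl) fun x => (tetraRegion_of_lt (x := x)).2.2.1
  · simpa [tetraVertex, tetraBend] using
      isGoodPath_cube_snd (.inr rfl) fun x => (tetraRegion_of_lt (x := x)).2.2.2.1
  · simpa [tetraVertex, tetraBend] using
      isGoodPath_cube_trd (.inl rfl) fun x => (tetraRegion_of_lt (x := x)).2.2.2.2.1
  · simpa [tetraVertex, tetraBend] using
      isGoodPath_cube_trd (.inr rfl) fun x => (tetraRegion_of_lt (x := x)).2.2.2.2.2

theorem two_pi_div_three_le_angle_tetra {i j l : Fin 4} (hij : i ≠ j) (hil : i ≠ l) (hjl : j ≠ l) :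
    2 * Real.pi / 3 ≤ angle (tetraBend i j - tetraVertex i) (tetraBend i l - tetraVertex i) := by
  refine two_pi_div_three_le_angle_of_sq ?_ ?_ <;> fin_cases i <;> fin_cases j <;> fin_cases l <;>
    simp [tetraVertex, tetraBend] at hij hil hjl ⊢ <;> norm_num

theorem isGoodDrawing_tetra : IsGoodDrawing ⊤ tetraVertex (twoBendSeq tetraVertex tetraBend)
    (2 * Real.pi / 3) := by
  refine isGoodDrawing_twoBendSeq tetraVertex_injective tetraRegion ?_
    (fun i j hij _ => isGoodPath_tetra hij)
    fun i j l hjl hij hil => two_pi_div_three_le_angle_tetra hij.ne hil.ne hjl.ne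
  intro i
  fin_cases i <;> simp [tetraVertex, tetraRegion]

theorem IsGoodPath.imp {a m m' b : Pt} {θ : ℝ} {P Q : Pt → Prop} (h : IsGoodPath a m m' b θ P)
    (hPQ : ∀ x, P x → Q x) : IsGoodPath a m m' b θ Q where
  mono := h.mono
  left := h.left
  right := h.right
  region := by
    obtain ⟨C, hC, hP⟩ := h.region
    exact ⟨C, hC, fun x hx => hPQ x (hP x hx)⟩

/-- The complete graph on four vertices with one edge subdivided by the vertex `4`. -/
def subdividedGraph : SimpleGraph (Fin 5) :=
  (⊤ : SimpleGraph (Fin 5)).deleteEdges {s(0, 1), s(2, 4), s(3, 4)}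

theorem subdividedGraph_adj {i j : Fin 5} : subdividedGraph.Adj i j ↔
    i ≠ j ∧ s(i, j) ≠ s(0, 1) ∧ s(i, j) ≠ s(2, 4) ∧ s(i, j) ≠ s(3, 4) := by
  simp [subdividedGraph]

/-- The vertices of the gadget for the subdivided complete graph. -/
def subdividedVertex (m : ℝ) : Fin 5 → Pt :=
  ![tetraVertex 0, tetraVertex 1, tetraVertex 2, tetraVertex 3, !₂[2 + m / 6, 0, 0]]

/-- The bends of the gadget for the subdivided complete graph. -/
def subdividedBend (m : ℝ) : Fin 5 → Fin 5 → Pt :=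
  ![![0, 0, tetraBend 0 2, tetraBend 0 3, tetraBend 0 1],
    ![0, 0, tetraBend 1 2, tetraBend 1 3, tetraBend 1 0],
    ![tetraBend 2 0, tetraBend 2 1, 0, tetraBend 2 3, 0],
    ![tetraBend 3 0, tetraBend 3 1, tetraBend 3 2, 0, 0],
    ![!₂[2 + m / 12, 1 / 4, 1 / 4], !₂[2 + m / 12, -1 / 4, -1 / 4], 0, 0, 0]]

/-- The edge of the subdivided complete graph to whose region a point belongs. -/
def subdividedRegion (x : Pt) : Option (Sym2 (Fin 5)) :=
  if tetraRegion x = some s(0, 1) then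
    if 0 < x 1 then some s(0, 4) else if x 1 < 0 then some s(1, 4) else none
  else (tetraRegion x).map (Sym2.map Fin.castSucc)

theorem isGoodPath_subdivided {m : ℝ} (hm : 0 < m) (hm2 : m ^ 2 = 6) {σ : ℝ}
    (hσ : σ = 1 ∨ σ = -1) {P : Pt → Prop}
    (hP : ∀ x : Pt, 1 < x 0 → |x 1| < 1 → |x 2| < 1 → 0 < σ * x 1 → P x) :
    IsGoodPath !₂[1, σ, σ] !₂[2, σ / 2, σ / 2] !₂[2 + m / 12, σ / 4, σ / 4] !₂[2 + m / 6, 0, 0]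
      (2 * Real.pi / 3) P := by
  constructor
  · refine ⟨innerₛₗ ℝ !₂[1, 0, 0], ?_, ?_, ?_⟩ <;> simp [inner_eq_sum] <;> linarith
  · refine two_pi_div_three_le_angle_of_sq ?_ ?_ <;> rcases hσ with rfl | rfl <;> simp <;> nlinarith
  · refine two_pi_div_three_le_angle_straight (r := -1) (by norm_num) ?_ ?_
    · intro h0
      have := congrArg (fun v : Pt => v 0) h0
      simp at this
      linarith
    · ext i; fin_cases i <;> simp <;> ring
  · refine ⟨[(!₂[1, 0, 0], 1), (!₂[0, 1, 0], -1), (!₂[0, -1, 0], -1), (!₂[0, 0, 1], -1),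
      (!₂[0, 0, -1], -1), (!₂[0, σ, 0], 0)], ?_, fun x hx => ?_⟩
    · rcases hσ with rfl | rfl <;> simp [inner_eq_sum] <;> constructorm* _ ∧ _ <;> linarith
    · simp [inner_eq_sum] at hx
      exact hP x (by linarith) (abs_lt.2 ⟨by linarith, by linarith⟩)
        (abs_lt.2 ⟨by linarith, by linarith⟩) (by linarith)

theorem isGoodPath_subdivided_of_tetra {i j : Fin 4} (hij : i < j) (h : s(i, j) ≠ s(0, 1)) :
    IsGoodPath (tetraVertex i) (tetraBend i j) (tetraBend j i) (tetraVertex j) (2 * Real.pi / 3)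
      fun x => subdividedRegion x = some s(i.castSucc, j.castSucc) :=
  (isGoodPath_tetra hij).imp fun x hx => by
    rw [subdividedRegion, hx, if_neg fun h' => h (Option.some_injective _ h')]
    rfl

theorem isGoodDrawing_subdivided {m : ℝ} (hm : 0 < m) (hm2 : m ^ 2 = 6) :
    IsGoodDrawing subdividedGraph (subdividedVertex m)
      (twoBendSeq (subdividedVertex m) (subdividedBend m)) (2 * Real.pi / 3) := by
  refine isGoodDrawing_twoBendSeq ?_ subdividedRegion ?_ ?_ ?_
  · intro i j hij
    have h0 := congrArg (fun v : Pt => v 0) hij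
    have h1 := congrArg (fun v : Pt => v 1) hij
    fin_cases i <;> fin_cases j <;> simp [subdividedVertex, tetraVertex] at h0 h1 ⊢ <;> linarith
  · intro i
    fin_cases i <;> simp [subdividedVertex, tetraVertex, subdividedRegion, tetraRegion]
    grind
  · intro i j hij hadj
    rw [subdividedGraph_adj] at hadj
    have : (i = 0 ∧ j = 2) ∨ (i = 0 ∧ j = 3) ∨ (i = 0 ∧ j = 4) ∨ (i = 1 ∧ j = 2) ∨
        (i = 1 ∧ j = 3) ∨ (i = 1 ∧ j = 4) ∨ (i = 2 ∧ j = 3) := by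
      revert i j; decide
    rcases this with ⟨rfl, rfl⟩ | ⟨rfl, rfl⟩ | ⟨rfl, rfl⟩ | ⟨rfl, rfl⟩ | ⟨rfl, rfl⟩ | ⟨rfl, rfl⟩ |
      ⟨rfl, rfl⟩
    · exact isGoodPath_subdivided_of_tetra (i := 0) (j := 2) (by decide) (by decide)
    · exact isGoodPath_subdivided_of_tetra (i := 0) (j := 3) (by decide) (by decide)
    · have := isGoodPath_subdivided hm hm2 (.inl rfl)
        (P := fun x => subdividedRegion x = some s(0, 4)) fun x hx h1 h2 h3 => by
          rw [subdividedRegion, if_pos (tetraRegion_of_lt.1 (by linarith) h1 h2),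
            if_pos (by linarith)]
      simpa [subdividedVertex, subdividedBend, tetraVertex, tetraBend] using this
    · exact isGoodPath_subdivided_of_tetra (i := 1) (j := 2) (by decide) (by decide)
    · exact isGoodPath_subdivided_of_tetra (i := 1) (j := 3) (by decide) (by decide)
    · have := isGoodPath_subdivided hm hm2 (.inr rfl)
        (P := fun x => subdividedRegion x = some s(1, 4)) fun x hx h1 h2 h3 => by
          rw [subdividedRegion, if_pos (tetraRegion_of_lt.1 (by linarith) h1 h2),
            if_neg (by linarith), if_pos (by linarith)]
      simpa [subdividedVertex, subdividedBend, tetraVertex, tetraBend] using this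
    · exact isGoodPath_subdivided_of_tetra (i := 2) (j := 3) (by decide) (by decide)
  · intro i j l hjl hij hil
    rw [subdividedGraph_adj] at hij hil
    have ht : ∀ {i j l : Fin 4}, i ≠ j ∧ i ≠ l ∧ j ≠ l → 2 * Real.pi / 3 ≤
        angle (tetraBend i j - tetraVertex i) (tetraBend i l - tetraVertex i) :=
      fun h => two_pi_div_three_le_angle_tetra h.1 h.2.1 h.2.2
    have : (i, j, l) ∈ [((0, 2, 3) : Fin 5 × Fin 5 × Fin 5), (0, 2, 4), (0, 3, 4), (1, 2, 3),
        (1, 2, 4), (1, 3, 4), (2, 0, 1), (2, 0, 3), (2, 1, 3), (3, 0, 1), (3, 0, 2), (3, 1, 2),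
        (4, 0, 1)] := by
      revert i j l
      set_option synthInstance.maxSize 2000 in
      set_option maxRecDepth 10000 in
      decide
    simp only [List.mem_cons, Prod.mk.injEq, List.not_mem_nil, or_false] at this
    rcases this with ⟨rfl, rfl, rfl⟩ | ⟨rfl, rfl, rfl⟩ | ⟨rfl, rfl, rfl⟩ | ⟨rfl, rfl, rfl⟩ |
      ⟨rfl, rfl, rfl⟩ | ⟨rfl, rfl, rfl⟩ | ⟨rfl, rfl, rfl⟩ | ⟨rfl, rfl, rfl⟩ | ⟨rfl, rfl, rfl⟩ |
      ⟨rfl, rfl, rfl⟩ | ⟨rfl, rfl, rfl⟩ | ⟨rfl, rfl, rfl⟩ | ⟨rfl, rfl, rfl⟩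
    · exact ht (i := 0) (j := 2) (l := 3) (by decide)
    · exact ht (i := 0) (j := 2) (l := 1) (by decide)
    · exact ht (i := 0) (j := 3) (l := 1) (by decide)
    · exact ht (i := 1) (j := 2) (l := 3) (by decide)
    · exact ht (i := 1) (j := 2) (l := 0) (by decide)
    · exact ht (i := 1) (j := 3) (l := 0) (by decide)
    · exact ht (i := 2) (j := 0) (l := 1) (by decide)
    · exact ht (i := 2) (j := 0) (l := 3) (by decide)
    · exact ht (i := 2) (j := 1) (l := 3) (by decide)
    · exact ht (i := 3) (j := 0) (l := 1) (by decide)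
    · exact ht (i := 3) (j := 0) (l := 2) (by decide)
    · exact ht (i := 3) (j := 1) (l := 2) (by decide)
    · refine two_pi_div_three_le_angle_of_sq ?_ ?_ <;> simp [subdividedVertex, subdividedBend] <;>
        nlinarith

theorem isPort_subdivided {m : ℝ} (hm : 0 < m) (hm2 : m ^ 2 = 6) :
    IsPort subdividedGraph (subdividedVertex m) (subdividedBend m) (2 * Real.pi / 3) 4
      !₂[1, 0, 0] := by
  refine ⟨?_, ?_, ?_, ?_⟩
  · exact ⟨2 + m / 6, by linarith, by ext i; fin_cases i <;> simp [subdividedVertex]⟩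
  · intro j hj
    fin_cases j <;> (rw [inner_eq_sum, inner_eq_sum]
                     simp [subdividedVertex, tetraVertex] at hj ⊢
                     try linarith)
  · intro j l hjl
    fin_cases j <;> fin_cases l <;> (rw [inner_eq_sum, inner_eq_sum]
                                     simp [subdividedVertex, subdividedBend, tetraBend]
                                     linarith)
  · intro j hj
    rw [subdividedGraph_adj] at hj
    have : j = 0 ∨ j = 1 := by
      revert j; decide
    rcases this with rfl | rfl <;> refine two_pi_div_three_le_angle_of_sq ?_ ?_ <;>
      simp [subdividedVertex, subdividedBend] <;> nlinarith

theorem exists_linearIsometryEquiv_single {e : Fin 3 → Pt} {s : Set (Fin 3)}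
    (he : Orthonormal ℝ (s.domRestrict e)) :
    ∃ L : Pt ≃ₗᵢ[ℝ] Pt, ∀ i ∈ s, L (EuclideanSpace.single i 1) = e i := by
  obtain ⟨b, hb⟩ := he.exists_orthonormalBasis_extension_of_card_eq (by simp)
  exact ⟨b.repr.symm, fun i hi => by rw [OrthonormalBasis.repr_symm_single, hb i hi]⟩

theorem exists_linearIsometryEquiv_one {d : Pt} (hd : ‖d‖ = 1) :
    ∃ L : Pt ≃ₗᵢ[ℝ] Pt, L !₂[1, 0, 0] = d := by
  obtain ⟨L, hL⟩ := exists_linearIsometryEquiv_single (e := fun _ => d) (s := {0})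
    ⟨fun _ => hd, fun i j hij => (hij (Subsingleton.elim _ _)).elim⟩
  refine ⟨L, ?_⟩
  rw [← hL 0 rfl]
  congr 1
  ext i; fin_cases i <;> simp

theorem exists_linearIsometryEquiv_two {d₁ d₂ : Pt} (h₁ : ‖d₁‖ = 1) (h₂ : ‖d₂‖ = 1)
    (h : inner ℝ d₁ d₂ ≤ -1 / 2) :
    ∃ (L : Pt ≃ₗᵢ[ℝ] Pt) (c s : ℝ), 0 < c ∧ 0 ≤ s ∧ s ≤ 1 / 2 ∧ c ^ 2 + s ^ 2 = 1 ∧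
      L !₂[c, s, 0] = d₁ ∧ L !₂[-c, s, 0] = d₂ := by
  set a : Pt := (1 / 2 : ℝ) • (d₁ - d₂) with ha
  set m : Pt := (1 / 2 : ℝ) • (d₁ + d₂) with hm
  have ham : inner ℝ a m = 0 := by
    simp only [ha, hm, inner_smul_left, inner_smul_right, inner_sub_left, inner_add_right,
      real_inner_self_eq_norm_sq, h₁, h₂, real_inner_comm d₂ d₁]
    simp
    ring
  have ha2 : ‖a‖ ^ 2 = (1 - inner ℝ d₁ d₂) / 2 := by
    rw [ha, norm_smul, mul_pow, norm_sub_sq_real, h₁, h₂]; norm_num; ring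
  have hm2 : ‖m‖ ^ 2 = (1 + inner ℝ d₁ d₂) / 2 := by
    rw [hm, norm_smul, mul_pow, norm_add_sq_real, h₁, h₂]; norm_num; ring
  have ha0 : 0 < ‖a‖ := by
    rcases (norm_nonneg a).eq_or_lt with h0 | h0
    · rw [← h0] at ha2; norm_num at ha2; linarith
    · exact h0
  have key : ∃ L : Pt ≃ₗᵢ[ℝ] Pt, ‖a‖ • L (EuclideanSpace.single 0 1) = a ∧
      ‖m‖ • L (EuclideanSpace.single 1 1) = m := by
    have ha1 : ‖‖a‖⁻¹ • a‖ = 1 := by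
      rw [norm_smul, norm_inv, norm_norm, inv_mul_cancel₀ ha0.ne']
    by_cases hm0 : m = 0
    · obtain ⟨L, hL⟩ := exists_linearIsometryEquiv_single (e := fun _ => ‖a‖⁻¹ • a) (s := {0})
        ⟨fun _ => ha1, fun i j hij => (hij (Subsingleton.elim _ _)).elim⟩
      exact ⟨L, by rw [hL 0 rfl, smul_inv_smul₀ ha0.ne'], by simp [hm0]⟩
    · have hm0' := norm_ne_zero_iff.2 hm0
      have hm1 : ‖‖m‖⁻¹ • m‖ = 1 := by
        rw [norm_smul, norm_inv, norm_norm, inv_mul_cancel₀ hm0']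
      obtain ⟨L, hL⟩ := exists_linearIsometryEquiv_single
        (e := ![‖a‖⁻¹ • a, ‖m‖⁻¹ • m, 0]) (s := {0, 1}) (by
          constructor
          · rintro ⟨i, rfl | rfl⟩
            · exact ha1
            · exact hm1
          · rintro ⟨i, rfl | rfl⟩ ⟨j, rfl | rfl⟩ hij
            · exact (hij rfl).elim
            · simp [inner_smul_left, inner_smul_right, ham]
            · simp [inner_smul_left, inner_smul_right, real_inner_comm a m ▸ ham]
            · exact (hij rfl).elim)
      exact ⟨L, by rw [hL 0 (by simp)]; exact smul_inv_smul₀ ha0.ne' _,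
        by rw [hL 1 (by simp)]; exact smul_inv_smul₀ hm0' _⟩
  obtain ⟨L, hLa, hLm⟩ := key
  refine ⟨L, ‖a‖, ‖m‖, ha0, norm_nonneg m, by nlinarith [norm_nonneg m],
    by rw [ha2, hm2]; ring, ?_, ?_⟩
  · rw [show (!₂[‖a‖, ‖m‖, 0] : Pt) = ‖a‖ • EuclideanSpace.single 0 1 +
        ‖m‖ • EuclideanSpace.single 1 1 by ext i; fin_cases i <;> simp,
      map_add, map_smul, map_smul, hLa, hLm, ha, hm]
    module
  · rw [show (!₂[-‖a‖, ‖m‖, 0] : Pt) = -‖a‖ • EuclideanSpace.single 0 1 +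
        ‖m‖ • EuclideanSpace.single 1 1 by ext i; fin_cases i <;> simp,
      map_add, neg_smul, map_neg, map_smul, map_smul, hLa, hLm, ha, hm]
    module

theorem exists_linearIsometryEquiv_three {d₁ d₂ d₃ : Pt} (h₁ : ‖d₁‖ = 1) (h₂ : ‖d₂‖ = 1)
    (h₃ : ‖d₃‖ = 1) (h₁₂ : inner ℝ d₁ d₂ ≤ -1 / 2) (h₁₃ : inner ℝ d₁ d₃ ≤ -1 / 2)
    (h₂₃ : inner ℝ d₂ d₃ ≤ -1 / 2) :
    ∃ (L : Pt ≃ₗᵢ[ℝ] Pt) (c s : ℝ), 0 < c ∧ 0 ≤ s ∧ s ≤ 1 / 2 ∧ c ^ 2 + s ^ 2 = 1 ∧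
      L !₂[c, s, 0] = d₁ ∧ L !₂[-c, s, 0] = d₂ ∧ L !₂[0, -1, 0] = d₃ := by
  obtain ⟨L, c, s, hc, hs0, hs, hcs, hL₁, hL₂⟩ := exists_linearIsometryEquiv_two h₁ h₂ h₁₂
  refine ⟨L, c, s, hc, hs0, hs, hcs, hL₁, hL₂, ?_⟩
  have hsum : d₁ + d₂ + d₃ = 0 := by
    rw [← norm_eq_zero, ← sq_eq_zero_iff]
    refine le_antisymm ?_ (sq_nonneg _)
    rw [norm_add_sq_real, norm_add_sq_real, inner_add_left, h₁, h₂, h₃]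
    linarith
  have h3 : L !₂[0, -(2 * s), 0] = d₃ := by
    rw [show (!₂[0, -(2 * s), 0] : Pt) = -(!₂[c, s, 0] + !₂[-c, s, 0]) by
      ext i; fin_cases i <;> simp; ring, map_neg, map_add, hL₁, hL₂]
    exact (eq_neg_of_add_eq_zero_right hsum).symm
  have hs1 : 2 * s = 1 := by
    have := congrArg norm h3
    rw [L.norm_map, h₃, EuclideanSpace.norm_eq] at this
    simpa [Fin.sum_univ_three, Real.sqrt_sq_eq_abs, abs_of_nonneg hs0] using this
  rwa [hs1] at h3

theorem exists_linearIsometryEquiv_of_imp {d₁ d₂ : Pt} {P₁ P₂ : Prop} (h₁ : ‖d₁‖ = 1)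
    (h₂ : ‖d₂‖ = 1) (h : P₁ → P₂ → inner ℝ d₁ d₂ ≤ -1 / 2) :
    ∃ (L : Pt ≃ₗᵢ[ℝ] Pt) (c s : ℝ), 0 < c ∧ 0 ≤ s ∧ s ≤ 1 / 2 ∧ c ^ 2 + s ^ 2 = 1 ∧
      (P₁ → L !₂[c, s, 0] = d₁) ∧ (P₂ → L !₂[-c, s, 0] = d₂) := by
  by_cases hP : P₁ ∧ P₂
  · obtain ⟨L, c, s, hc, hs0, hs, hcs, hL₁, hL₂⟩ :=
      exists_linearIsometryEquiv_two h₁ h₂ (h hP.1 hP.2)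
    exact ⟨L, c, s, hc, hs0, hs, hcs, fun _ => hL₁, fun _ => hL₂⟩
  · have hneg : ∀ {d : Pt}, ‖d‖ = 1 → inner ℝ d (-d) ≤ -1 / 2 := fun {d} hd => by
      rw [inner_neg_right, real_inner_self_eq_norm_sq, hd]; norm_num
    by_cases hP₁ : P₁
    · obtain ⟨L, c, s, hc, hs0, hs, hcs, hL₁, -⟩ :=
        exists_linearIsometryEquiv_two h₁ (by rwa [norm_neg]) (hneg h₁)
      exact ⟨L, c, s, hc, hs0, hs, hcs, fun _ => hL₁, fun h2 => (hP ⟨hP₁, h2⟩).elim⟩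
    · obtain ⟨L, c, s, hc, hs0, hs, hcs, -, hL₂⟩ :=
        exists_linearIsometryEquiv_two (d₁ := -d₂) (by rwa [norm_neg]) h₂
          (by rw [real_inner_comm]; exact hneg h₂)
      exact ⟨L, c, s, hc, hs0, hs, hcs, fun h1 => (hP₁ h1).elim, fun _ => hL₂⟩

theorem IsGoodDrawing.exists_direction {W : Type*} {Γ₀ : SimpleGraph W} {p : W → Pt}
    {S : W → W → List Pt} (h₀ : IsGoodDrawing Γ₀ p S (2 * Real.pi / 3)) (y : W) :
    ∃ d : W → Pt, (∀ b, ‖d b‖ = 1) ∧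
      (∀ b, Γ₀.Adj y b → ∀ q, (S y b)[1]? = some q → ∃ t : ℝ, 0 < t ∧ q - p y = t • d b) ∧
      ∀ b b', Γ₀.Adj y b → Γ₀.Adj y b' → b ≠ b' → inner ℝ (d b) (d b') ≤ -1 / 2 := by
  have key : ∀ b, ∃ d : Pt, ‖d‖ = 1 ∧ (Γ₀.Adj y b → ∃ t : ℝ, 0 < t ∧ ∃ q,
      (S y b)[1]? = some q ∧ q - p y = t • d) := by
    intro b
    by_cases hb : Γ₀.Adj y b
    · obtain ⟨q, l, hS⟩ := h₀.exists_eq_cons_cons hb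
      have hne : p y ≠ q := (simplePolyline_cons_cons.1 (hS ▸ h₀.simple y b hb)).1
      have hpos : 0 < ‖q - p y‖ := norm_pos_iff.2 (sub_ne_zero.2 hne.symm)
      exact ⟨‖q - p y‖⁻¹ • (q - p y), by
        rw [norm_smul, norm_inv, norm_norm, inv_mul_cancel₀ hpos.ne'],
        fun _ => ⟨‖q - p y‖, hpos, q, by simp [hS], (smul_inv_smul₀ hpos.ne' _).symm⟩⟩
    · exact ⟨EuclideanSpace.single 0 1, by simp, fun h => (hb h).elim⟩
  choose d hd1 hd using key
  refine ⟨d, hd1, fun b hb q hq => ?_, fun b b' hb hb' hne => ?_⟩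
  · obtain ⟨t, ht, q', hq', h⟩ := hd b hb
    rw [hq, Option.some_inj] at hq'
    exact ⟨t, ht, hq' ▸ h⟩
  · obtain ⟨t, ht, q, hq, h⟩ := hd b hb
    obtain ⟨t', ht', q', hq', h'⟩ := hd b' hb'
    have := h₀.star _ _ _ hb hb' hne _ _ hq hq'
    rw [h, h', angle_smul_left_of_pos _ _ ht, angle_smul_right_of_pos _ _ ht'] at this
    exact inner_le_of_two_pi_div_three_le_angle (hd1 b) (hd1 b') this

/-- `Γ` arises from `Γ₀` by replacing the vertex `y` with the vertices in the range of `ι`, each of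
which has at most one neighbour outside this range; `ψ` embeds the other vertices into `Γ₀`. -/
structure IsExpansion {κ W W' : Type*} (Γ₀ : SimpleGraph W) (y : W) (Γ : SimpleGraph W')
    (ι : κ → W') (ψ : W' → W) : Prop where
  ne : ∀ a, a ∉ Set.range ι → ψ a ≠ y
  inj : ∀ a b, a ∉ Set.range ι → b ∉ Set.range ι → ψ a = ψ b → a = b
  adj : ∀ a b, a ∉ Set.range ι → b ∉ Set.range ι → Γ.Adj a b → Γ₀.Adj (ψ a) (ψ b)
  adj_center : ∀ i a, a ∉ Set.range ι → Γ.Adj (ι i) a → Γ₀.Adj y (ψ a)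
  eq_of_adj : ∀ i a b, a ∉ Set.range ι → b ∉ Set.range ι → Γ.Adj (ι i) a → Γ.Adj (ι i) b → a = b
  eq_of_adj' : ∀ i j a, a ∉ Set.range ι → Γ.Adj (ι i) a → Γ.Adj (ι j) a → i = j

theorem IsExpansion.comp {κ W W' : Type*} {Γ₀ : SimpleGraph W} {y : W} {Γ : SimpleGraph W'}
    {ι : κ → W'} {ψ : W' → W} (h : IsExpansion Γ₀ y Γ ι ψ) (σ : Equiv.Perm κ) :
    IsExpansion Γ₀ y Γ (ι ∘ σ) ψ := by
  have hr : Set.range (ι ∘ σ) = Set.range ι := σ.surjective.range_comp ι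
  constructor <;> rw [hr]
  · exact h.ne
  · exact h.inj
  · exact h.adj
  · exact fun i => h.adj_center (σ i)
  · exact fun i => h.eq_of_adj (σ i)
  · exact fun i j a ha hi hj => σ.injective (h.eq_of_adj' _ _ a ha hi hj)

/-- The gadget vertex `ι i` has a neighbour outside the gadget. -/
def HasOuter {κ W' : Type*} (Γ : SimpleGraph W') (ι : κ → W') (i : κ) : Prop :=
  ∃ a, a ∉ Set.range ι ∧ Γ.Adj (ι i) a

theorem IsExpansion.exists_direction {κ W W' : Type*} {Γ₀ : SimpleGraph W} {y : W}
    {Γ : SimpleGraph W'} {ι : κ → W'} {ψ : W' → W} (h : IsExpansion Γ₀ y Γ ι ψ) {p : W → Pt}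
    {S : W → W → List Pt} (h₀ : IsGoodDrawing Γ₀ p S (2 * Real.pi / 3)) :
    ∃ e : κ → Pt, (∀ i, ‖e i‖ = 1) ∧
      (∀ i a, a ∉ Set.range ι → Γ.Adj (ι i) a → ∀ q, (S y (ψ a))[1]? = some q →
        ∃ t : ℝ, 0 < t ∧ q - p y = t • e i) ∧
      ∀ i j, i ≠ j → HasOuter Γ ι i → HasOuter Γ ι j → inner ℝ (e i) (e j) ≤ -1 / 2 := by
  classical
  obtain ⟨d, hd1, hd, hdd⟩ := h₀.exists_direction y
  have key : ∀ i, ∃ e : Pt, ‖e‖ = 1 ∧ ∀ a, a ∉ Set.range ι → Γ.Adj (ι i) a → e = d (ψ a) := by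
    intro i
    by_cases hi : HasOuter Γ ι i
    · obtain ⟨a, ha, hia⟩ := hi
      exact ⟨d (ψ a), hd1 _, fun b hb hib => by rw [h.eq_of_adj i a b ha hb hia hib]⟩
    · exact ⟨d y, hd1 y, fun a ha hia => (hi ⟨a, ha, hia⟩).elim⟩
  choose e he1 he using key
  refine ⟨e, he1, fun i a ha hia q hq => ?_, ?_⟩
  · rw [he i a ha hia]
    exact hd _ (h.adj_center i a ha hia) q hq
  · rintro i j hij ⟨a, ha, hia⟩ ⟨b, hb, hjb⟩
    rw [he i a ha hia, he j b hb hjb]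
    refine hdd _ _ (h.adj_center i a ha hia) (h.adj_center j b hb hjb) fun hab => hij ?_
    obtain rfl := h.inj a b ha hb hab
    exact h.eq_of_adj' i j a ha hia hjb

theorem IsExpansion.hasGoodDrawing {κ W W' : Type*} [Finite κ] [Finite W] {Γ₀ : SimpleGraph W}
    {y : W} {Γ : SimpleGraph W'} {ι : κ → W'} {ψ : W' → W} (h : IsExpansion Γ₀ y Γ ι ψ)
    {p : W → Pt} {S : W → W → List Pt} {θ : ℝ} (h₀ : IsGoodDrawing Γ₀ p S θ)
    {H : SimpleGraph κ} (hH : ∀ i j, Γ.Adj (ι i) (ι j) → H.Adj i j) {g : κ → Pt}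
    {n : κ → κ → Pt} (hg : IsGoodDrawing H g (twoBendSeq g n) θ) (L : Pt ≃ₗᵢ[ℝ] Pt) {e : κ → Pt}
    (he : ∀ i a, a ∉ Set.range ι → Γ.Adj (ι i) a → ∀ q, (S y (ψ a))[1]? = some q →
        ∃ t : ℝ, 0 < t ∧ q - p y = t • e i)
    (hport : ∀ i, HasOuter Γ ι i → ∃ δ, IsPort H g n θ i δ ∧ L δ = e i) : HasGoodDrawing Γ θ := by
  classical
  have hport' : ∀ i, ∃ δ, HasOuter Γ ι i → IsPort H g n θ i δ ∧ L δ = e i := fun i => by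
    by_cases hi : HasOuter Γ ι i
    · exact (hport i hi).imp fun _ h _ => h
    · exact ⟨0, fun h => (hi h).elim⟩
  choose δ hδ using hport'
  refine h₀.hasGoodDrawing_of_gadget h.ne h.inj h.adj h.adj_center h.eq_of_adj h.eq_of_adj' hH hg L
    δ (fun i a ha hia => (hδ i ⟨a, ha, hia⟩).1) fun i a ha hia q hq => ?_
  rw [(hδ i ⟨a, ha, hia⟩).2]
  exact he i a ha hia q hq

theorem IsExpansion.hasGoodDrawing_triangle {W W' : Type*} [Finite W] {Γ₀ : SimpleGraph W} {y : W}
    {Γ : SimpleGraph W'} {ι : Fin 3 → W'} {ψ : W' → W} (h : IsExpansion Γ₀ y Γ ι ψ)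
    (h₀ : HasGoodDrawing Γ₀ (2 * Real.pi / 3)) : HasGoodDrawing Γ (2 * Real.pi / 3) := by
  obtain ⟨p, S, h₀⟩ := h₀
  by_cases hall : ∀ i, HasOuter Γ ι i
  · obtain ⟨e, he1, he, hee⟩ := h.exists_direction h₀
    obtain ⟨L, c, s, hc, hs0, hs, hcs, hL₁, hL₂, hL₃⟩ :=
      exists_linearIsometryEquiv_three (he1 0) (he1 1) (he1 2)
        (hee 0 1 (by decide) (hall 0) (hall 1)) (hee 0 2 (by decide) (hall 0) (hall 2))
        (hee 1 2 (by decide) (hall 1) (hall 2))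
    obtain ⟨g, n, hg, hp₀, hp₁, hp₂⟩ := exists_triangle_gadget hc hs0 hs hcs
    refine h.hasGoodDrawing h₀ (fun i j hij => ?_) hg L he fun i _ => ?_
    · rintro rfl; exact hij.ne rfl
    · fin_cases i
      · exact ⟨_, hp₀, hL₁⟩
      · exact ⟨_, hp₁, hL₂⟩
      · exact ⟨_, hp₂, hL₃⟩
  · push Not at hall
    obtain ⟨k, hk⟩ := hall
    have h' := h.comp (Equiv.swap k 2)
    have hk' : ¬ HasOuter Γ (ι ∘ Equiv.swap k 2) 2 := by
      rwa [HasOuter, (Equiv.swap k 2).surjective.range_comp, Function.comp_apply,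
        Equiv.swap_apply_right]
    obtain ⟨e, he1, he, hee⟩ := h'.exists_direction h₀
    obtain ⟨L, c, s, hc, hs0, hs, hcs, hL₁, hL₂⟩ :=
      exists_linearIsometryEquiv_of_imp (he1 0) (he1 1) (hee 0 1 (by decide))
    obtain ⟨g, n, hg, hp₀, hp₁, -⟩ := exists_triangle_gadget hc hs0 hs hcs
    refine h'.hasGoodDrawing h₀ (fun i j hij => ?_) hg L he fun i hi => ?_
    · rintro rfl; exact hij.ne rfl
    · fin_cases i
      · exact ⟨_, hp₀, hL₁ hi⟩
      · exact ⟨_, hp₁, hL₂ hi⟩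
      · exact (hk' hi).elim

theorem IsExpansion.hasGoodDrawing_diamond {W W' : Type*} [Finite W] {Γ₀ : SimpleGraph W} {y : W}
    {Γ : SimpleGraph W'} {ι : Fin 4 → W'} {ψ : W' → W} (h : IsExpansion Γ₀ y Γ ι ψ)
    (h01 : ¬ Γ.Adj (ι 0) (ι 1)) (h2 : ¬ HasOuter Γ ι 2) (h3 : ¬ HasOuter Γ ι 3)
    (h₀ : HasGoodDrawing Γ₀ (2 * Real.pi / 3)) : HasGoodDrawing Γ (2 * Real.pi / 3) := by
  obtain ⟨p, S, h₀⟩ := h₀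
  obtain ⟨e, he1, he, hee⟩ := h.exists_direction h₀
  obtain ⟨L, c, s, hc, hs0, hs, hcs, hL₁, hL₂⟩ :=
    exists_linearIsometryEquiv_of_imp (he1 0) (he1 1) (hee 0 1 (by decide))
  obtain ⟨g, n, hg, hp₀, hp₁⟩ := exists_diamond_gadget hc hs0 hs hcs
  refine h.hasGoodDrawing h₀ (fun i j hij => diamondGraph_adj.2 ⟨?_, fun he => ?_⟩) hg L he
    fun i hi => ?_
  · rintro rfl; exact hij.ne rfl
  · rcases Sym2.eq_iff.1 he with ⟨rfl, rfl⟩ | ⟨rfl, rfl⟩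
    · exact h01 hij
    · exact h01 hij.symm
  · fin_cases i
    · exact ⟨_, hp₀, hL₁ hi⟩
    · exact ⟨_, hp₁, hL₂ hi⟩
    · exact (h2 hi).elim
    · exact (h3 hi).elim

theorem IsExpansion.hasGoodDrawing_tetra {W W' : Type*} [Finite W] {Γ₀ : SimpleGraph W} {y : W}
    {Γ : SimpleGraph W'} {ι : Fin 4 → W'} {ψ : W' → W} (h : IsExpansion Γ₀ y Γ ι ψ)
    (hout : ∀ i, ¬ HasOuter Γ ι i)
    (h₀ : HasGoodDrawing Γ₀ (2 * Real.pi / 3)) : HasGoodDrawing Γ (2 * Real.pi / 3) := by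
  obtain ⟨p, S, h₀⟩ := h₀
  obtain ⟨e, he1, he, hee⟩ := h.exists_direction h₀
  refine h.hasGoodDrawing h₀ (fun i j hij => ?_) isGoodDrawing_tetra (.refl ℝ Pt) he
    fun i hi => (hout i hi).elim
  rintro rfl; exact hij.ne rfl

theorem IsExpansion.hasGoodDrawing_subdivided {W W' : Type*} [Finite W] {Γ₀ : SimpleGraph W}
    {y : W} {Γ : SimpleGraph W'} {ι : Fin 5 → W'} {ψ : W' → W} (h : IsExpansion Γ₀ y Γ ι ψ)
    (h01 : ¬ Γ.Adj (ι 0) (ι 1)) (h24 : ¬ Γ.Adj (ι 2) (ι 4)) (h34 : ¬ Γ.Adj (ι 3) (ι 4))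
    (hout : ∀ i, HasOuter Γ ι i → i = 4)
    (h₀ : HasGoodDrawing Γ₀ (2 * Real.pi / 3)) : HasGoodDrawing Γ (2 * Real.pi / 3) := by
  obtain ⟨p, S, h₀⟩ := h₀
  obtain ⟨e, he1, he, hee⟩ := h.exists_direction h₀
  obtain ⟨L, hL⟩ := exists_linearIsometryEquiv_one (he1 4)
  have hm : 0 < √(6 : ℝ) := Real.sqrt_pos.2 (by norm_num)
  have hm2 : √(6 : ℝ) ^ 2 = 6 := Real.sq_sqrt (by norm_num)
  have hne : ∀ {i j k l : Fin 5}, ¬ Γ.Adj (ι k) (ι l) → Γ.Adj (ι i) (ι j) → s(i, j) ≠ s(k, l) := by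
    rintro i j k l hkl hij he
    rcases Sym2.eq_iff.1 he with ⟨rfl, rfl⟩ | ⟨rfl, rfl⟩
    · exact hkl hij
    · exact hkl hij.symm
  refine h.hasGoodDrawing h₀ (fun i j hij => subdividedGraph_adj.2 ⟨?_, hne h01 hij, hne h24 hij,
    hne h34 hij⟩) (isGoodDrawing_subdivided hm hm2) L he fun i hi => ?_
  · rintro rfl; exact hij.ne rfl
  · obtain rfl := hout i hi
    exact ⟨_, isPort_subdivided hm hm2, hL⟩

theorem adj_imp_eq_of_degree_le_three {W : Type*} {Γ : SimpleGraph W} {a : W}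
    [Fintype (Γ.neighborSet a)] (hdeg : Γ.degree a ≤ 3) {b c d : W} (hb : Γ.Adj a b)
    (hc : Γ.Adj a c) (hd : Γ.Adj a d) (hbc : b ≠ c) (hbd : b ≠ d) (hcd : c ≠ d) {e : W}
    (he : Γ.Adj a e) : e = b ∨ e = c ∨ e = d := by
  classical
  by_contra! hne
  have hsub : ({e, b, c, d} : Finset W) ⊆ Γ.neighborFinset a := by
    intro f hf
    simp only [Finset.mem_insert, Finset.mem_singleton] at hf
    rw [SimpleGraph.mem_neighborFinset]
    rcases hf with rfl | rfl | rfl | rfl <;> assumption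
  have hcard := Finset.card_le_card hsub
  rw [SimpleGraph.card_neighborFinset_eq_degree, Finset.card_insert_of_notMem (by simp [hne]),
    Finset.card_insert_of_notMem (by simp [hbc, hbd]), Finset.card_pair hcd] at hcard
  omega

section Contraction

variable {κ W W' : Type*} {Γ₀ : SimpleGraph W} {y : W} {Γ : SimpleGraph W'} {K : Set W'}
  {ι : κ → W'}

open Classical in
/-- The contraction map sending all of `K` to the vertex `y`. -/
def contractionMap (φ : {a : W' // a ∉ K} ≃ {b : W // b ≠ y}) (a : W') : W :=
  if h : a ∉ K then φ ⟨a, h⟩ else y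

theorem contractionMap_of_notMem (φ : {a : W' // a ∉ K} ≃ {b : W // b ≠ y}) {a : W'}
    (h : a ∉ K) : contractionMap φ a = φ ⟨a, h⟩ := dif_pos h

theorem contractionMap_inj (φ : {a : W' // a ∉ K} ≃ {b : W // b ≠ y}) {a b : W'}
    (ha : a ∉ K) (hb : b ∉ K) (h : contractionMap φ a = contractionMap φ b) : a = b := by
  rw [contractionMap_of_notMem φ ha, contractionMap_of_notMem φ hb] at h
  exact congrArg Subtype.val (φ.injective (Subtype.ext h))

theorem contractionMap_adj {φ : {a : W' // a ∉ K} ≃ {b : W // b ≠ y}}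
    (hφ : ∀ a b : {a : W' // a ∉ K}, Γ₀.Adj (φ a : W) (φ b : W) ↔ Γ.Adj (a : W') (b : W'))
    {a b : W'} (ha : a ∉ K) (hb : b ∉ K) (h : Γ.Adj a b) :
    Γ₀.Adj (contractionMap φ a) (contractionMap φ b) := by
  rw [contractionMap_of_notMem φ ha, contractionMap_of_notMem φ hb]
  exact (hφ _ _).2 h

theorem isExpansion_contractionMap {φ : {a : W' // a ∉ K} ≃ {b : W // b ≠ y}}
    (hφ : ∀ a b : {a : W' // a ∉ K}, Γ₀.Adj (φ a : W) (φ b : W) ↔ Γ.Adj (a : W') (b : W'))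
    (hy : ∀ a : {a : W' // a ∉ K}, Γ₀.Adj y (φ a : W) ↔ ∃ z ∈ K, Γ.Adj z (a : W'))
    (hK : Set.range ι = K)
    (h1 : ∀ i a b, a ∉ K → b ∉ K → Γ.Adj (ι i) a → Γ.Adj (ι i) b → a = b)
    (h2 : ∀ i j a, a ∉ K → Γ.Adj (ι i) a → Γ.Adj (ι j) a → i = j) :
    IsExpansion Γ₀ y Γ ι (contractionMap φ) := by
  constructor <;> rw [hK]
  · intro a ha
    rw [contractionMap_of_notMem φ ha]
    exact (φ ⟨a, ha⟩).2
  · exact fun a b ha hb => contractionMap_inj φ ha hb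
  · exact fun a b ha hb => contractionMap_adj hφ ha hb
  · intro i a ha hia
    rw [contractionMap_of_notMem φ ha]
    exact (hy _).2 ⟨ι i, hK ▸ Set.mem_range_self i, hia⟩
  · exact h1
  · exact h2

/-- If `z ∉ K` and no vertex of `K` has a neighbour outside `insert z K`, then one can also expand
`z` instead of `y`. -/
theorem isExpansion_contractionMap_insert {φ : {a : W' // a ∉ K} ≃ {b : W // b ≠ y}}
    (hφ : ∀ a b : {a : W' // a ∉ K}, Γ₀.Adj (φ a : W) (φ b : W) ↔ Γ.Adj (a : W') (b : W'))
    {z : W'} (hz : z ∉ K) (hK : Set.range ι = insert z K) {i₀ : κ} (hi₀ : ι i₀ = z)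
    (h1 : ∀ a b, a ∉ insert z K → b ∉ insert z K → Γ.Adj z a → Γ.Adj z b → a = b)
    (h2 : ∀ i a, a ∉ insert z K → Γ.Adj (ι i) a → i = i₀) :
    IsExpansion Γ₀ (contractionMap φ z) Γ ι (contractionMap φ) := by
  have hout : ∀ {a}, a ∉ insert z K → a ∉ K := fun ha h => ha (.inr h)
  constructor <;> rw [hK]
  · exact fun a ha h => ha (.inl (contractionMap_inj φ (hout ha) hz h))
  · exact fun a b ha hb => contractionMap_inj φ (hout ha) (hout hb)
  · exact fun a b ha hb => contractionMap_adj hφ (hout ha) (hout hb)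
  · intro i a ha hia
    obtain rfl := h2 i a ha hia
    rw [hi₀] at hia
    exact contractionMap_adj hφ hz (hout ha) hia
  · intro i a b ha hb hia hib
    obtain rfl := h2 i a ha hia
    rw [hi₀] at hia hib
    exact h1 a b ha hb hia hib
  · intro i j a ha hi hj
    rw [h2 i a ha hi, h2 j a ha hj]

end Contraction

/-- Let `G` have maximum degree at most three and contain a triangle
`uvw`.  Let `K = {u,v,w}` if no other triangle of `G` shares a vertex with `uvw`
(a Δ–Y transformation), and otherwise `K = {u,v,w,x}` where `vwx` is another triangle;
let `G'` be obtained from `G` by contracting `K` to a single new vertex `y`, adjacent to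
exactly those vertices outside `K` adjacent in `G` to a vertex of `K` (this is expressed
by the equivalence `φ` between the non-`K` vertices of `G` and the non-`y` vertices of
`G'`).  If `G'` has a non-crossing polyline drawing with at most two bends per edge and
angular resolution at least `2π/3`, then so does `G`. -/
theorem triangle_contraction_drawing (V V' : Type) [Fintype V] [DecidableEq V]
    [Fintype V'] [DecidableEq V']
    (G : SimpleGraph V) [DecidableRel G.Adj] (G' : SimpleGraph V')
    (hdeg : ∀ a, G.degree a ≤ 3)
    (u v w : V) (huv : G.Adj u v) (hvw : G.Adj v w) (huw : G.Adj u w)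
    (K : Set V) (y : V')
    (hcase :
      ((∀ a b c : V, G.Adj a b → G.Adj b c → G.Adj a c →
          ({a, b, c} : Set V) ∩ {u, v, w} ≠ ∅ → ({a, b, c} : Set V) = {u, v, w}) ∧
        K = {u, v, w}) ∨
      (∃ x : V, G.Adj v x ∧ G.Adj w x ∧ x ∉ ({u, v, w} : Set V) ∧ K = {u, v, w, x}))
    (φ : {a : V // a ∉ K} ≃ {b : V' // b ≠ y})
    (hφ : ∀ a b : {a : V // a ∉ K}, G'.Adj (φ a : V') (φ b : V') ↔ G.Adj (a : V) (b : V))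
    (hy : ∀ a : {a : V // a ∉ K}, G'.Adj y (φ a : V') ↔ ∃ z ∈ K, G.Adj z (a : V))
    (hdraw' : ∃ D' : PolylineDrawing G',
      NonCrossing D' ∧ MaxBends D' 2 ∧ AngularResAtLeast D' (2 * Real.pi / 3)) :
    ∃ D : PolylineDrawing G,
      NonCrossing D ∧ MaxBends D 2 ∧ AngularResAtLeast D (2 * Real.pi / 3) := by
  rw [← hasGoodDrawing_iff] at hdraw' ⊢
  have deg := fun {a b c d e : V} => adj_imp_eq_of_degree_le_three (hdeg a) (b := b) (c := c)
    (d := d) (e := e)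
  rcases hcase with ⟨htri, hK⟩ | ⟨x, hvx, hwx, hx, hK⟩
  · have hnot : ∀ {a}, a ∉ K → a ≠ u ∧ a ≠ v ∧ a ≠ w := fun ha => by simpa [hK] using ha
    have hcommon : ∀ {a b c}, ({a, b} : Set V) ⊆ {u, v, w} → G.Adj a b → c ∉ K → G.Adj a c →
        ¬ G.Adj b c := by
      intro a b c hab hadj hc hac hbc
      refine hc ?_
      rw [hK, ← htri a b c hadj hbc hac (Set.Nonempty.ne_empty ⟨a, by simp, hab (by simp)⟩)]
      simp
    have hu : ∀ {a b}, a ∉ K → b ∉ K → G.Adj u a → G.Adj u b → a = b := fun {a b} ha hb h h' => by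
      have := deg huv huw h hvw.ne (hnot ha).2.1.symm (hnot ha).2.2.symm h'
      have := hnot hb
      tauto
    have hv : ∀ {a b}, a ∉ K → b ∉ K → G.Adj v a → G.Adj v b → a = b := fun {a b} ha hb h h' => by
      have := deg huv.symm hvw h huw.ne (hnot ha).1.symm (hnot ha).2.2.symm h'
      have := hnot hb
      tauto
    have hw : ∀ {a b}, a ∉ K → b ∉ K → G.Adj w a → G.Adj w b → a = b := fun {a b} ha hb h h' => by
      have := deg huw.symm hvw.symm h huv.ne (hnot ha).1.symm (hnot ha).2.1.symm h'
      have := hnot hb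
      tauto
    refine (isExpansion_contractionMap (ι := ![u, v, w]) hφ hy ?_ ?_ ?_).hasGoodDrawing_triangle
      hdraw'
    · rw [hK]; ext a; simp; grind
    · intro i a b ha hb
      fin_cases i
      · exact hu ha hb
      · exact hv ha hb
      · exact hw ha hb
    · intro i j a ha hi hj
      have h1 : G.Adj u a → ¬ G.Adj v a := hcommon (by simp [Set.insert_subset_iff]) huv ha
      have h2 : G.Adj u a → ¬ G.Adj w a := hcommon (by simp [Set.insert_subset_iff]) huw ha
      have h3 : G.Adj v a → ¬ G.Adj w a := hcommon (by simp) hvw ha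
      fin_cases i <;> fin_cases j <;> simp at hi hj ⊢ <;> tauto
  · simp only [Set.mem_insert_iff, Set.mem_singleton_iff, not_or, ← ne_eq] at hx
    obtain ⟨hxu, hxv, hxw⟩ := hx
    have hnot : ∀ {a}, a ∉ K → a ≠ u ∧ a ≠ v ∧ a ≠ w ∧ a ≠ x := fun ha => by simpa [hK] using ha
    have hv : ∀ {a}, a ∉ K → ¬ G.Adj v a := fun {a} ha h => by
      have := deg huv.symm hvw hvx huw.ne hxu.symm hxw.symm h
      have := hnot ha
      tauto
    have hw : ∀ {a}, a ∉ K → ¬ G.Adj w a := fun {a} ha h => by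
      have := deg huw.symm hvw.symm hwx huv.ne hxu.symm hxv.symm h
      have := hnot ha
      tauto
    have hu : ∀ {a b}, a ∉ K → G.Adj u a → G.Adj u b → b = v ∨ b = w ∨ b = a := fun ha h h' =>
      deg huv huw h hvw.ne (hnot ha).2.1.symm (hnot ha).2.2.1.symm h'
    have hx : ∀ {a b}, a ∉ K → G.Adj x a → G.Adj x b → b = v ∨ b = w ∨ b = a := fun ha h h' =>
      deg hvx.symm hwx.symm h hvw.ne (hnot ha).2.1.symm (hnot ha).2.2.1.symm h'
    have hKι : Set.range ![u, x, v, w] = K := by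
      rw [hK]; ext a; simp; grind
    by_cases hz : ∃ z, z ∉ K ∧ G.Adj u z ∧ G.Adj x z
    · obtain ⟨z, hzK, huz, hxz⟩ := hz
      have hux : ¬ G.Adj u x := fun h => by
        have := hu hzK huz h
        have := hnot hzK
        tauto
      have hnot' : ∀ {a}, a ∉ insert z K → a ≠ z ∧ a ∉ K := fun ha => by simpa using ha
      have hout : ∀ i a, a ∉ insert z K → G.Adj (![u, x, v, w, z] i) a → i = 4 := by
        intro i a ha hia
        obtain ⟨haz, haK⟩ := hnot' ha
        have := hnot haK
        fin_cases i
        · have := hu hzK huz hia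
          tauto
        · have := hx hzK hxz hia
          tauto
        · exact (hv haK hia).elim
        · exact (hw haK hia).elim
        · rfl
      have hrange : Set.range ![u, x, v, w, z] = insert z K := by
        rw [← hKι]; ext a; simp
      refine (isExpansion_contractionMap_insert (ι := ![u, x, v, w, z]) (i₀ := 4) hφ hzK hrange rfl
        (fun a b ha hb hza hzb => ?_) hout).hasGoodDrawing_subdivided hux (hv hzK) (hw hzK) ?_
        hdraw'
      · have h1 := hnot (hnot' ha).2
        have h2 := hnot (hnot' hb).2
        have := deg huz.symm hxz.symm hza hxu.symm h1.1.symm h1.2.2.2.symm hzb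
        tauto
      · rintro i ⟨a, ha, hia⟩
        exact hout i a (hrange ▸ ha) hia
    · push Not at hz
      have hexp : IsExpansion G' y G ![u, x, v, w] (contractionMap φ) := by
        refine isExpansion_contractionMap hφ hy hKι ?_ ?_
        · intro i a b ha hb hia hib
          have := hnot hb
          fin_cases i
          · have := hu ha hia hib
            tauto
          · have := hx ha hia hib
            tauto
          · exact (hv ha hia).elim
          · exact (hw ha hia).elim
        · intro i j a ha hi hj
          have h1 := hz a ha
          have h2 := hv ha
          have h3 := hw ha
          fin_cases i <;> fin_cases j <;> simp at hi hj ⊢ <;> tauto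
      have h2 : ¬ HasOuter G ![u, x, v, w] 2 := fun ⟨a, ha, h⟩ => hv (hKι ▸ ha) h
      have h3 : ¬ HasOuter G ![u, x, v, w] 3 := fun ⟨a, ha, h⟩ => hw (hKι ▸ ha) h
      by_cases hux : G.Adj u x
      · refine hexp.hasGoodDrawing_tetra (fun i hi => ?_) hdraw'
        fin_cases i
        · obtain ⟨a, ha, h⟩ := hi
          rw [hKι] at ha
          have := hu ha h hux
          have := hnot ha
          tauto
        · obtain ⟨a, ha, h⟩ := hi
          rw [hKι] at ha
          have := hx ha h hux.symm
          have := hnot ha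
          have := huv.ne
          have := huw.ne
          tauto
        · exact h2 hi
        · exact h3 hi
      · exact hexp.hasGoodDrawing_diamond hux h2 h3 hdraw'
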